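/- arXiv:1802.03918 — 2 statements merged into one kernel-verified Lean document; each statement's English description precedes it below -/
import Mathlib

section
/- For all integers k ≥ 5 and n ≥ 2k, the rainbow number of the matching kK₂ with respect to the class of plane triangulations on n vertices satisfies rb(𝒯ₙ, kK₂) ≤ 2n + 6k − 16; that is, for every plane triangulation T on n vertices, every edge-coloring of T using at least 2n + 6k − 16 distinct colors contains a rainbow matching of size k. -/
/-- A topological planar embedding of a simple graph `G`: an injective placement `f` of the
vertices in the plane together with, for each edge, an arc `γ e : ℝ → ℝ × ℝ` that is
continuous and injective on `[0,1]`, joins the images of the two endpoints of the edge,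
whose interior avoids all vertex images, and such that interiors of distinct arcs are
pairwise disjoint. -/
def SimpleGraph.IsPlanarEmbedding {V : Type*} (G : SimpleGraph V) (f : V → ℝ × ℝ)
    (γ : G.edgeSet → ℝ → ℝ × ℝ) : Prop :=
  Function.Injective f ∧
  (∀ e : G.edgeSet, ContinuousOn (γ e) (Set.Icc 0 1)) ∧
  (∀ e : G.edgeSet, Set.InjOn (γ e) (Set.Icc 0 1)) ∧
  (∀ e : G.edgeSet, ∃ u v : V, (e : Sym2 V) = s(u, v) ∧ γ e 0 = f u ∧ γ e 1 = f v) ∧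
  (∀ e : G.edgeSet, ∀ t ∈ Set.Ioo (0 : ℝ) 1, ∀ v : V, γ e t ≠ f v) ∧
  (∀ e₁ e₂ : G.edgeSet, e₁ ≠ e₂ → ∀ t₁ ∈ Set.Ioo (0 : ℝ) 1, ∀ t₂ ∈ Set.Ioo (0 : ℝ) 1,
      γ e₁ t₁ ≠ γ e₂ t₂)

/-- A simple graph is planar if it admits a topological planar embedding. -/
def SimpleGraph.IsPlanar {V : Type*} (G : SimpleGraph V) : Prop :=
  ∃ f γ, G.IsPlanarEmbedding f γ

/-- A plane triangulation on `n` vertices: a maximal planar simple graph on `n ≥ 3`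
vertices, i.e. a planar graph with exactly `3n - 6` edges. -/
def IsPlaneTriangulation {n : ℕ} (G : SimpleGraph (Fin n)) : Prop :=
  3 ≤ n ∧ G.IsPlanar ∧ G.edgeSet.ncard = 3 * n - 6

/-- `M` is a matching of size `k` in `G` (a copy of `kK₂`): a set of `k` pairwise
vertex-disjoint edges of `G`. -/
def IsMatchingOfSize {V : Type*} (G : SimpleGraph V) (M : Finset (Sym2 V)) (k : ℕ) : Prop :=
  M.card = k ∧ (↑M : Set (Sym2 V)) ⊆ G.edgeSet ∧
    ∀ e ∈ M, ∀ e' ∈ M, e ≠ e' → ∀ v : V, v ∈ e → v ∉ e'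

/-- Under the edge-coloring `c`, the graph `G` contains a rainbow matching of size `k`. -/
def HasRainbowMatching {V α : Type*} (G : SimpleGraph V) (c : Sym2 V → α) (k : ℕ) : Prop :=
  ∃ M : Finset (Sym2 V), IsMatchingOfSize G M k ∧ Set.InjOn c (↑M : Set (Sym2 V))

/-- `r` colors suffice for rainbow `kK₂` in every plane triangulation on `n` vertices:
every edge-coloring of such a triangulation using at least `r` distinct colors contains
a rainbow matching of size `k`. -/
def RainbowThreshold (n k r : ℕ) : Prop :=
  ∀ G : SimpleGraph (Fin n), IsPlaneTriangulation G →
    ∀ c : Sym2 (Fin n) → ℕ, r ≤ (c '' G.edgeSet).ncard → HasRainbowMatching G c k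



/-! ### Plane segments: parity of crossings -/
namespace RbMatch

set_option linter.unusedSimpArgs false
set_option linter.unusedVariables false

/-- Height at abscissa `x` of the line through `c` and `d`. -/
noncomputable def lineY (c d : ℝ × ℝ) (x : ℝ) : ℝ := c.2 + (d.2 - c.2) * ((x - c.1) / (d.1 - c.1))

/-- The abscissa `x` is strictly between those of `c` and `d`. -/
def InRange (c d : ℝ × ℝ) (x : ℝ) : Prop := (c.1 < x ∧ x < d.1) ∨ (d.1 < x ∧ x < c.1)

open Classical in
/-- `p` lies below the segment `cd`. -/
noncomputable def belowSeg (p c d : ℝ × ℝ) : ZMod 2 :=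
  if InRange c d p.1 ∧ p.2 < lineY c d p.1 then 1 else 0

open Classical in
/-- `p` lies above the segment `cd`. -/
noncomputable def aboveSeg (p c d : ℝ × ℝ) : ZMod 2 :=
  if InRange c d p.1 ∧ lineY c d p.1 < p.2 then 1 else 0

open Classical in
/-- order bit -/
noncomputable def ordBit (x y : ℝ) : ZMod 2 := if x < y then 1 else 0

/-- The two segments have no common point. -/
def SegDisj (a b c d : ℝ × ℝ) : Prop :=
  ∀ s r : ℝ, 0 ≤ s → s ≤ 1 → 0 ≤ r → r ≤ 1 →
    a.1 + s * (b.1 - a.1) = c.1 + r * (d.1 - c.1) →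
    a.2 + s * (b.2 - a.2) = c.2 + r * (d.2 - c.2) → False

lemma SegDisj.swap {a b c d : ℝ × ℝ} (h : SegDisj a b c d) : SegDisj c d a b :=
  fun s r h1 h2 h3 h4 h5 h6 => h r s h3 h4 h1 h2 h5.symm h6.symm

lemma SegDisj.rev {a b c d : ℝ × ℝ} (h : SegDisj a b c d) : SegDisj b a c d :=
  fun s r h1 h2 h3 h4 h5 h6 => h (1 - s) r (by linarith) (by linarith) h3 h4
    (by linarith) (by linarith)

lemma lineY_swap (c d : ℝ × ℝ) (x : ℝ) (h : c.1 ≠ d.1) : lineY c d x = lineY d c x := by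
  have h1 : d.1 - c.1 ≠ 0 := sub_ne_zero.2 h.symm
  have h2 : c.1 - d.1 ≠ 0 := sub_ne_zero.2 h
  unfold lineY
  have : (x - d.1) / (c.1 - d.1) = 1 - (x - c.1) / (d.1 - c.1) := by
    field_simp
    rw [show c.1 - d.1 = -(d.1 - c.1) by ring]
    field_simp
    ring
  rw [this]; ring

lemma InRange.ne {c d : ℝ × ℝ} {x : ℝ} (h : InRange c d x) : c.1 ≠ d.1 := by
  rcases h with h | h <;> intro h' <;> linarith [h.1, h.2]

lemma inRange_swap {c d : ℝ × ℝ} {x : ℝ} : InRange c d x ↔ InRange d c x := by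
  unfold InRange; tauto

lemma belowSeg_swap (p c d : ℝ × ℝ) : belowSeg p c d = belowSeg p d c := by
  unfold belowSeg
  congr 1
  apply propext
  constructor
  · rintro ⟨h1, h2⟩
    exact ⟨inRange_swap.1 h1, by rwa [lineY_swap _ _ _ h1.ne] at h2⟩
  · rintro ⟨h1, h2⟩
    exact ⟨inRange_swap.1 h1, by rwa [lineY_swap _ _ _ h1.ne] at h2⟩

lemma aboveSeg_swap (p c d : ℝ × ℝ) : aboveSeg p c d = aboveSeg p d c := by
  unfold aboveSeg
  congr 1
  apply propext
  constructor
  · rintro ⟨h1, h2⟩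
    exact ⟨inRange_swap.1 h1, by rwa [lineY_swap _ _ _ h1.ne] at h2⟩
  · rintro ⟨h1, h2⟩
    exact ⟨inRange_swap.1 h1, by rwa [lineY_swap _ _ _ h1.ne] at h2⟩

lemma lineY_ne {a b c d : ℝ × ℝ} (h : SegDisj a b c d) (hab : a.1 < b.1) (hcd : c.1 < d.1)
    {x : ℝ} (h1 : a.1 ≤ x) (h2 : x ≤ b.1) (h3 : c.1 ≤ x) (h4 : x ≤ d.1) :
    lineY a b x ≠ lineY c d x := by
  intro he
  have p1 : 0 < b.1 - a.1 := by linarith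
  have p2 : 0 < d.1 - c.1 := by linarith
  refine h ((x - a.1) / (b.1 - a.1)) ((x - c.1) / (d.1 - c.1)) (div_nonneg (by linarith) p1.le)
    ((div_le_one p1).2 (by linarith)) (div_nonneg (by linarith) p2.le)
    ((div_le_one p2).2 (by linarith)) ?_ ?_
  · rw [div_mul_cancel₀ _ p1.ne', div_mul_cancel₀ _ p2.ne']; ring
  · unfold lineY at he; linarith

lemma lineY_lt {a b c d : ℝ × ℝ} (h : SegDisj a b c d) (hab : a.1 < b.1) (hcd : c.1 < d.1)
    {x y : ℝ} (h1 : a.1 ≤ x) (h2 : x ≤ b.1) (h3 : c.1 ≤ x) (h4 : x ≤ d.1)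
    (k1 : a.1 ≤ y) (k2 : y ≤ b.1) (k3 : c.1 ≤ y) (k4 : y ≤ d.1)
    (hl : lineY a b x < lineY c d x) : lineY a b y < lineY c d y := by
  by_contra hcon
  push Not at hcon
  have cont : Continuous (fun z => lineY a b z - lineY c d z) := by
    unfold lineY; fun_prop
  have hpre : (Set.Icc (max a.1 c.1) (min b.1 d.1)).OrdConnected := inferInstance
  have := (Set.ordConnected_iff_uIcc_subset.1 hpre)
    (x := x) ⟨max_le h1 h3, le_min h2 h4⟩ (y := y) ⟨max_le k1 k3, le_min k2 k4⟩
  obtain ⟨z, hz, hz0⟩ := (intermediate_value_uIcc (a := x) (b := y) cont.continuousOn)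
    (show (0 : ℝ) ∈ _ from by
      rw [Set.mem_uIcc]; left; constructor <;> linarith)
  have hz' := this hz
  exact lineY_ne h hab hcd (le_trans (le_max_left _ _) hz'.1) (le_trans hz'.2 (min_le_left _ _))
    (le_trans (le_max_right _ _) hz'.1) (le_trans hz'.2 (min_le_right _ _)) (sub_eq_zero.1 hz0)

lemma lineY_left (a b : ℝ × ℝ) : lineY a b a.1 = a.2 := by simp [lineY]
lemma lineY_right (a b : ℝ × ℝ) (h : a.1 < b.1) : lineY a b b.1 = b.2 := by
  have p1 : b.1 - a.1 ≠ 0 := by intro h'; linarith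
  simp [lineY, div_self p1]

lemma seg_sum_aux {a b c d : ℝ × ℝ} (h : SegDisj a b c d) (hab : a.1 < b.1) (hcd : c.1 < d.1)
    (hac : a.1 ≠ c.1) (had : a.1 ≠ d.1) (hbc : b.1 ≠ c.1) (hbd : b.1 ≠ d.1) :
    belowSeg a c d + belowSeg b c d + aboveSeg c a b + aboveSeg d a b = 0 := by
  have key := @lineY_lt a b c d h hab hcd
  have la := lineY_left a b
  have lb := lineY_right a b hab
  have lc := lineY_left c d
  have ld := lineY_right c d hcd
  have z2 : (1 : ZMod 2) + 1 = 0 := by decide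
  have ra : ∀ x, InRange a b x ↔ (a.1 < x ∧ x < b.1) := fun x =>
    ⟨fun h => h.elim id (fun h => by linarith [h.1, h.2]), Or.inl⟩
  have rc : ∀ x, InRange c d x ↔ (c.1 < x ∧ x < d.1) := fun x =>
    ⟨fun h => h.elim id (fun h => by linarith [h.1, h.2]), Or.inl⟩
  unfold belowSeg aboveSeg
  simp only [ra, rc]
  rcases lt_or_gt_of_ne hac with h1 | h1 <;> rcases lt_or_gt_of_ne hbd with h2 | h2
  · skip
    rcases lt_or_gt_of_ne hbc with h3 | h3
    · have e1 : ¬ (c.1 < a.1) := by linarith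
      have e2 : ¬ (c.1 < b.1) := by linarith
      have e3 : ¬ (d.1 < b.1) := by linarith
      simp [e1, e2, e3]
    · have e1 : ¬ (c.1 < a.1) := by linarith
      have e3 : ¬ (d.1 < b.1) := by linarith
      have k1 := key (x := c.1) (y := b.1) h1.le h3.le le_rfl hcd.le hab.le le_rfl h3.le h2.le
      have k2 := key (y := c.1) (x := b.1) hab.le le_rfl h3.le h2.le h1.le h3.le le_rfl hcd.le
      rw [lb, lc] at k1 k2
      by_cases q : lineY a b c.1 < c.2
      · simp [e1, e3, q, k1 q, h1, h2, h3, z2]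
      · simp [e1, e3, q, fun q' => q (k2 q'), not_lt.1 (fun q' => q (k2 q'))]
  · skip
    have e1 : ¬ (c.1 < a.1) := by linarith
    have e3 : ¬ (b.1 < d.1) := by linarith
    have h3 : c.1 < b.1 := by linarith
    have h4 : a.1 < d.1 := by linarith
    have k1 := key (x := c.1) (y := d.1) h1.le h3.le le_rfl hcd.le h4.le h2.le hcd.le le_rfl
    have k2 := key (y := c.1) (x := d.1) h4.le h2.le hcd.le le_rfl h1.le h3.le le_rfl hcd.le
    rw [ld, lc] at k1 k2
    by_cases q : lineY a b c.1 < c.2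
    · simp [e1, e3, q, k1 q, h1, h2, h3, h4, z2]
    · simp [e1, e3, q, not_lt.1 (fun q' => q (k2 q'))]
  · skip
    have e1 : ¬ (a.1 < c.1) := by linarith
    have e3 : ¬ (d.1 < b.1) := by linarith
    have h3 : c.1 < b.1 := by linarith
    have h4 : a.1 < d.1 := by linarith
    have k1 := key (x := a.1) (y := b.1) le_rfl hab.le h1.le h4.le hab.le le_rfl h3.le h2.le
    have k2 := key (y := a.1) (x := b.1) hab.le le_rfl h3.le h2.le le_rfl hab.le h1.le h4.le
    rw [la, lb] at k1 k2
    by_cases q : a.2 < lineY c d a.1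
    · simp [e1, e3, q, k1 q, h1, h2, h3, h4, z2]
    · simp [e1, e3, q, not_lt.1 (fun q' => q (k2 q'))]
  · skip
    rcases lt_or_gt_of_ne had with h3 | h3
    · have e1 : ¬ (a.1 < c.1) := by linarith
      have e3 : ¬ (b.1 < d.1) := by linarith
      have k1 := key (x := a.1) (y := d.1) le_rfl hab.le h1.le h3.le h3.le h2.le hcd.le le_rfl
      have k2 := key (y := a.1) (x := d.1) h3.le h2.le hcd.le le_rfl le_rfl hab.le h1.le h3.le
      rw [la, ld] at k1 k2
      by_cases q : a.2 < lineY c d a.1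
      · simp [e1, e3, q, k1 q, h1, h2, h3, z2]
      · simp [e1, e3, q, not_lt.1 (fun q' => q (k2 q'))]
    · have e1 : ¬ (a.1 < d.1) := by linarith
      have e2 : ¬ (b.1 < d.1) := by linarith
      have e3 : ¬ (a.1 < c.1) := by linarith
      simp [e1, e2, e3]

lemma belowSeg_self (p c : ℝ × ℝ) : belowSeg p c c = 0 := by
  have : ¬ InRange c c p.1 := fun h => h.ne rfl
  simp [belowSeg, this]

lemma aboveSeg_self (p c : ℝ × ℝ) : aboveSeg p c c = 0 := by
  have : ¬ InRange c c p.1 := fun h => h.ne rfl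
  simp [aboveSeg, this]

lemma seg_sum {a b c d : ℝ × ℝ} (h : SegDisj a b c d) (hab : a.1 = b.1 → a = b)
    (hcd : c.1 = d.1 → c = d)
    (hac : a.1 ≠ c.1) (had : a.1 ≠ d.1) (hbc : b.1 ≠ c.1) (hbd : b.1 ≠ d.1) :
    belowSeg a c d + belowSeg b c d + aboveSeg c a b + aboveSeg d a b = 0 := by
  have z2 : ∀ x : ZMod 2, x + x = 0 := by decide
  rcases lt_trichotomy a.1 b.1 with h1 | h1 | h1
  · rcases lt_trichotomy c.1 d.1 with h2 | h2 | h2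
    · exact seg_sum_aux h h1 h2 hac had hbc hbd
    · rw [hcd h2]; simp [belowSeg_self, z2]
    · have := seg_sum_aux h.swap.rev.swap h1 h2 had hac hbd hbc
      rw [belowSeg_swap a, belowSeg_swap b, ← this]; ring
  · rw [hab h1]; simp [aboveSeg_self, z2]
  · rcases lt_trichotomy c.1 d.1 with h2 | h2 | h2
    · have := seg_sum_aux h.rev h1 h2 hbc hbd hac had
      rw [aboveSeg_swap c, aboveSeg_swap d, ← this]; ring
    · rw [hcd h2]; simp [belowSeg_self, z2]
    · have := seg_sum_aux h.rev.swap.rev.swap h1 h2 hbd hbc had hac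
      rw [belowSeg_swap a, belowSeg_swap b, aboveSeg_swap c, aboveSeg_swap d, ← this]; ring

lemma above_eq {p q c d : ℝ × ℝ} (h : SegDisj p q c d) (hc : p.1 ≠ c.1) (hd : p.1 ≠ d.1) :
    aboveSeg p c d = belowSeg p c d + (ordBit c.1 p.1 + ordBit d.1 p.1) := by
  have z2 : (1 : ZMod 2) + 1 = 0 := by decide
  have hne : InRange c d p.1 → p.2 ≠ lineY c d p.1 := by
    intro hr he
    have hn : d.1 - c.1 ≠ 0 := sub_ne_zero.2 hr.ne.symm
    have hr' : 0 ≤ (p.1 - c.1) / (d.1 - c.1) ∧ (p.1 - c.1) / (d.1 - c.1) ≤ 1 := by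
      rcases hr with ⟨h1, h2⟩ | ⟨h1, h2⟩
      · exact ⟨div_nonneg (by linarith) (by linarith), (div_le_one (by linarith)).2 (by linarith)⟩
      · exact ⟨div_nonneg_of_nonpos (by linarith) (by linarith),
          (div_le_one_of_neg (by linarith)).2 (by linarith)⟩
    refine h 0 ((p.1 - c.1) / (d.1 - c.1)) le_rfl zero_le_one hr'.1 hr'.2 ?_ ?_
    · rw [div_mul_cancel₀ _ hn]; ring
    · unfold lineY at he; linarith
  unfold aboveSeg belowSeg ordBit
  by_cases hr : InRange c d p.1
  · have h1 := hne hr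
    rcases lt_or_gt_of_ne h1 with h2 | h2 <;> rcases hr with hr | hr
    · simp [h2, h2.not_gt, InRange, hr, hr.2.not_gt, z2]
    · simp [h2, h2.not_gt, InRange, hr, hr.2.not_gt, z2]
    · simp [h2, h2.not_gt, InRange, hr, hr.2.not_gt]
    · simp [h2, h2.not_gt, InRange, hr, hr.2.not_gt]
  · simp only [hr, false_and, if_false]
    unfold InRange at hr
    rcases lt_or_gt_of_ne hc with h1 | h1 <;> rcases lt_or_gt_of_ne hd with h2 | h2
    · simp [h1.not_gt, h2.not_gt]
    · exact absurd (Or.inr ⟨h2, h1⟩) hr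
    · exact absurd (Or.inl ⟨h1, h2⟩) hr
    · simp [h1, h2, z2]

lemma tele (g : ℕ → ZMod 2) (N : ℕ) :
    ∑ i ∈ Finset.range N, (g i + g (i + 1)) = g 0 + g N := by
  have z2 : ∀ x : ZMod 2, x + x = 0 := by decide
  induction N with
  | zero => simp [z2]
  | succ n ih =>
    rw [Finset.sum_range_succ, ih, show g 0 + g n + (g n + g (n + 1))
      = g 0 + g (n + 1) + (g n + g n) by ring, z2, add_zero]

/-- Parity identity for two disjoint polylines. -/
lemma poly_sum (q r : ℕ → ℝ × ℝ) (N : ℕ) (hN : 0 < N)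
    (hq : ∀ i < N, (q i).1 = (q (i + 1)).1 → q i = q (i + 1))
    (hr : ∀ i < N, (r i).1 = (r (i + 1)).1 → r i = r (i + 1))
    (hqr : ∀ i ≤ N, ∀ j ≤ N, (q i).1 ≠ (r j).1)
    (hd : ∀ i < N, ∀ j < N, SegDisj (q i) (q (i + 1)) (r j) (r (j + 1))) :
    (∑ j ∈ Finset.range N, belowSeg (q 0) (r j) (r (j + 1)))
     + (∑ j ∈ Finset.range N, belowSeg (q N) (r j) (r (j + 1)))
     + ((∑ i ∈ Finset.range N, belowSeg (r 0) (q i) (q (i + 1)))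
        + (ordBit (q 0).1 (r 0).1 + ordBit (q N).1 (r 0).1))
     + ((∑ i ∈ Finset.range N, belowSeg (r N) (q i) (q (i + 1)))
        + (ordBit (q 0).1 (r N).1 + ordBit (q N).1 (r N).1)) = 0 := by
  have A0 : ∑ i ∈ Finset.range N, aboveSeg (r 0) (q i) (q (i + 1))
      = (∑ i ∈ Finset.range N, belowSeg (r 0) (q i) (q (i + 1)))
        + (ordBit (q 0).1 (r 0).1 + ordBit (q N).1 (r 0).1) := by
    rw [← tele (fun i => ordBit (q i).1 (r 0).1) N, ← Finset.sum_add_distrib]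
    refine Finset.sum_congr rfl fun i hi => ?_
    have hi := Finset.mem_range.1 hi
    exact above_eq (hd i hi 0 hN).swap (hqr i hi.le 0 (Nat.zero_le _)).symm
      (hqr (i + 1) hi 0 (Nat.zero_le _)).symm
  obtain ⟨m, rfl⟩ : ∃ m, N = m + 1 := ⟨N - 1, by omega⟩
  have A1 : ∑ i ∈ Finset.range (m+1), aboveSeg (r (m+1)) (q i) (q (i + 1))
      = (∑ i ∈ Finset.range (m+1), belowSeg (r (m+1)) (q i) (q (i + 1)))
        + (ordBit (q 0).1 (r (m+1)).1 + ordBit (q (m+1)).1 (r (m+1)).1) := by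
    rw [← tele (fun i => ordBit (q i).1 (r (m+1)).1) (m+1), ← Finset.sum_add_distrib]
    refine Finset.sum_congr rfl fun i hi => ?_
    have hi := Finset.mem_range.1 hi
    exact above_eq (hd i hi m (by omega)).swap.rev (hqr i hi.le (m+1) le_rfl).symm
      (hqr (i + 1) hi (m+1) le_rfl).symm
  rw [← A0, ← A1]
  have T1 : ∑ i ∈ Finset.range (m+1), ∑ j ∈ Finset.range (m+1),
      (belowSeg (q i) (r j) (r (j+1)) + belowSeg (q (i+1)) (r j) (r (j+1))
        + aboveSeg (r j) (q i) (q (i+1)) + aboveSeg (r (j+1)) (q i) (q (i+1))) = 0 := by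
    refine Finset.sum_eq_zero fun i hi => Finset.sum_eq_zero fun j hj => ?_
    have hi := Finset.mem_range.1 hi
    have hj := Finset.mem_range.1 hj
    exact seg_sum (hd i hi j hj) (hq i hi) (hr j hj) (hqr _ hi.le _ hj.le) (hqr _ hi.le _ hj)
      (hqr _ hi _ hj.le) (hqr _ hi _ hj)
  rw [← T1]
  have T2 : ∑ i ∈ Finset.range (m+1), ∑ j ∈ Finset.range (m+1),
      (belowSeg (q i) (r j) (r (j+1)) + belowSeg (q (i+1)) (r j) (r (j+1)))
      = (∑ j ∈ Finset.range (m+1), belowSeg (q 0) (r j) (r (j + 1)))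
       + (∑ j ∈ Finset.range (m+1), belowSeg (q (m+1)) (r j) (r (j + 1))) := by
    rw [Finset.sum_comm, ← Finset.sum_add_distrib]
    exact Finset.sum_congr rfl fun j _ => tele (fun i => belowSeg (q i) (r j) (r (j+1))) _
  have T3 : ∑ i ∈ Finset.range (m+1), ∑ j ∈ Finset.range (m+1),
      (aboveSeg (r j) (q i) (q (i+1)) + aboveSeg (r (j+1)) (q i) (q (i+1)))
      = (∑ i ∈ Finset.range (m+1), aboveSeg (r 0) (q i) (q (i + 1)))
       + (∑ i ∈ Finset.range (m+1), aboveSeg (r (m+1)) (q i) (q (i + 1))) := by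
    rw [← Finset.sum_add_distrib]
    exact Finset.sum_congr rfl fun i _ => tele (fun j => aboveSeg (r j) (q i) (q (i+1))) _
  rw [add_assoc _ (∑ i ∈ _, aboveSeg _ _ _) _, ← T2, ← T3, ← Finset.sum_add_distrib]
  refine Finset.sum_congr rfl fun i _ => ?_
  rw [← Finset.sum_add_distrib]
  exact Finset.sum_congr rfl fun j _ => by ring

end RbMatch

/-! ### Drawn graphs -/
namespace RbMatch

/-- A weak form of planarity: vertices are points, every edge joins its ends inside a set, and the
sets of independent edges are disjoint. -/
def Drawn {W : Type*} (H : SimpleGraph W) : Prop :=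
  ∃ (f : W → ℝ × ℝ) (S : W → W → Set (ℝ × ℝ)),
    (∀ u v, H.Adj u v → JoinedIn (S u v) (f u) (f v)) ∧
    ∀ u v x y, H.Adj u v → H.Adj x y → u ≠ x → u ≠ y → v ≠ x → v ≠ y → Disjoint (S u v) (S x y)

lemma shear {ι : Type*} [Finite ι] (P : ι → ℝ × ℝ) :
    ∃ t : ℝ, ∀ i j, P i ≠ P j → (P i).1 + t * (P i).2 ≠ (P j).1 + t * (P j).2 := by
  have hfin : (Set.range (fun p : ι × ι =>
      -((P p.1).1 - (P p.2).1) / ((P p.1).2 - (P p.2).2))).Finite := Set.finite_range _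
  obtain ⟨t, ht⟩ := hfin.infinite_compl.nonempty
  refine ⟨t, fun i j hij he => ?_⟩
  by_cases h2 : (P i).2 = (P j).2
  · apply hij
    rw [h2] at he
    exact Prod.ext (by linarith) h2
  · apply ht
    refine ⟨(i, j), ?_⟩
    have : (P i).2 - (P j).2 ≠ 0 := sub_ne_zero.2 h2
    simp only
    rw [div_eq_iff this]
    linarith

lemma seg_eventually (g g' : ℝ → ℝ × ℝ) (hg : Continuous g) (hg' : Continuous g')
    (hd : ∀ s ∈ Set.Icc (0:ℝ) 1, ∀ t ∈ Set.Icc (0:ℝ) 1, g s ≠ g' t) :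
    ∀ᶠ N : ℕ in Filter.atTop, ∀ i < N, ∀ j < N, ∀ s r : ℝ, 0 ≤ s → s ≤ 1 → 0 ≤ r → r ≤ 1 →
      g (i / N) + s • (g ((i + 1 : ℕ) / N) - g (i / N)) ≠
      g' (j / N) + r • (g' ((j + 1 : ℕ) / N) - g' (j / N)) := by
  have hc : IsCompact (Set.Icc (0:ℝ) 1 ×ˢ Set.Icc (0:ℝ) 1) := isCompact_Icc.prod isCompact_Icc
  obtain ⟨z, hz, hmin⟩ := hc.exists_isMinOn ⟨(0, 0), by simp⟩
    (f := fun p : ℝ × ℝ => dist (g p.1) (g' p.2)) (by fun_prop)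
  have hpos : 0 < dist (g z.1) (g' z.2) := dist_pos.2 (hd _ hz.1 _ hz.2)
  set ε := dist (g z.1) (g' z.2) with hε
  have hge : ∀ s ∈ Set.Icc (0:ℝ) 1, ∀ t ∈ Set.Icc (0:ℝ) 1, ε ≤ dist (g s) (g' t) :=
    fun s hs t ht => hmin (a := (s, t)) ⟨hs, ht⟩
  have near : ∀ h : ℝ → ℝ × ℝ, Continuous h → ∀ᶠ N : ℕ in Filter.atTop, ∀ i < N,
      dist (h ((i + 1 : ℕ) / N)) (h (i / N)) < ε / 2 := by
    intro h hh
    have hu := isCompact_Icc.uniformContinuousOn_of_continuous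
      (hh.continuousOn (s := Set.Icc (0:ℝ) 1))
    rw [Metric.uniformContinuousOn_iff] at hu
    obtain ⟨δ, hδ, hu⟩ := hu (ε / 2) (by linarith)
    obtain ⟨N0, hN0⟩ := exists_nat_gt (1 / δ)
    filter_upwards [Filter.eventually_ge_atTop (N0 + 1)] with N hN i hi
    have hNpos : (0:ℝ) < N := by exact_mod_cast (by omega : 0 < N)
    have hiN : (i:ℝ) + 1 ≤ N := by exact_mod_cast hi
    have hi0 : (0:ℝ) ≤ i := Nat.cast_nonneg _
    apply hu
    · exact ⟨by positivity, (div_le_one hNpos).2 (by push_cast; linarith)⟩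
    · exact ⟨by positivity, (div_le_one hNpos).2 (by linarith)⟩
    · rw [Real.dist_eq, ← sub_div]
      have : ((i + 1 : ℕ) : ℝ) - i = 1 := by push_cast; ring
      rw [this, abs_of_pos (by positivity), div_lt_iff₀ hNpos]
      have h1 : (N0:ℝ) < N := by exact_mod_cast (by omega : N0 < N)
      rw [div_lt_iff₀ hδ] at hN0
      nlinarith
  filter_upwards [near g hg, near g' hg'] with N h1 h2 i hi j hj s r hs0 hs1 hr0 hr1 he
  have hNpos : (0:ℝ) < N := by exact_mod_cast (by omega : 0 < N)
  have hiN : (i:ℝ) + 1 ≤ N := by exact_mod_cast hi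
  have hjN : (j:ℝ) + 1 ≤ N := by exact_mod_cast hj
  have step : ∀ (a b : ℝ × ℝ) (s : ℝ), 0 ≤ s → s ≤ 1 → dist b a < ε / 2 →
      dist (a + s • (b - a)) a < ε / 2 := by
    intro a b s h0 h1 hab
    rw [dist_eq_norm] at hab ⊢
    rw [add_sub_cancel_left, norm_smul, Real.norm_of_nonneg h0]
    nlinarith [norm_nonneg (b - a)]
  have q1 := step _ _ s hs0 hs1 (h1 i hi)
  have q2 := step _ _ r hr0 hr1 (h2 j hj)
  rw [he] at q1
  have := hge (i / N) ⟨by positivity, (div_le_one hNpos).2 (by linarith)⟩ (j / N)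
    ⟨by positivity, (div_le_one hNpos).2 (by linarith)⟩
  have tri := dist_triangle_left (g (i / N)) (g' (j / N))
    (g' (j / N) + r • (g' ((j + 1 : ℕ) / N) - g' (j / N)))
  linarith

lemma drawn_cochain {W : Type*} [Finite W] (H : SimpleGraph W) (hD : Drawn H)
    (hsep : ∀ u v : W, u ≠ v → ∃ u' v', H.Adj u u' ∧ H.Adj v v' ∧ u ≠ v' ∧ u' ≠ v ∧ u' ≠ v') :
    ∃ (o : W → W → ZMod 2) (b : W → W → W → ZMod 2), (∀ u v, u ≠ v → o u v + o v u = 1) ∧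
      ∀ u v x y, H.Adj u v → H.Adj x y → u ≠ x → u ≠ y → v ≠ x → v ≠ y →
        b u x y + b v x y + (b x u v + (o u x + o v x)) + (b y u v + (o u y + o v y)) = 0 := by
  classical
  obtain ⟨f, S, hS, hdis⟩ := hD
  have hg : ∀ u v, ∃ g : ℝ → ℝ × ℝ, H.Adj u v → (Continuous g ∧ g 0 = f u ∧ g 1 = f v ∧
      ∀ t ∈ Set.Icc (0:ℝ) 1, g t ∈ S u v) := by
    intro u v
    by_cases h : H.Adj u v
    · refine ⟨(hS u v h).somePath.extend, fun _ => ⟨Path.continuous_extend _,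
        Path.extend_zero _, Path.extend_one _, fun t ht => ?_⟩⟩
      rw [Path.extend_apply _ ht]
      exact JoinedIn.somePath_mem _ _
    · exact ⟨fun _ => 0, fun h' => absurd h' h⟩
  choose g hg using hg
  have ev : ∀ᶠ N : ℕ in Filter.atTop, ∀ u v x y, H.Adj u v → H.Adj x y → u ≠ x → u ≠ y → v ≠ x →
      v ≠ y → ∀ i < N, ∀ j < N, ∀ s r : ℝ, 0 ≤ s → s ≤ 1 → 0 ≤ r → r ≤ 1 →
      g u v (i / N) + s • (g u v ((i + 1 : ℕ) / N) - g u v (i / N)) ≠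
      g x y (j / N) + r • (g x y ((j + 1 : ℕ) / N) - g x y (j / N)) := by
    simp only [Filter.eventually_all]
    intro u v x y h1 h2 h3 h4 h5 h6
    obtain ⟨a1, a2, a3, a4⟩ := hg u v h1
    obtain ⟨b1, b2, b3, b4⟩ := hg x y h2
    exact seg_eventually _ _ a1 b1 fun s hs t ht he =>
      Set.disjoint_left.1 (hdis u v x y h1 h2 h3 h4 h5 h6) (a4 s hs) (he ▸ b4 t ht)
  obtain ⟨N, hN, hN0⟩ := (ev.and (Filter.eventually_gt_atTop 0)).exists
  have hNpos : (0:ℝ) < N := by exact_mod_cast hN0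
  obtain ⟨t, ht⟩ := shear (fun p : W × W × Fin (N + 1) => g p.1 p.2.1 ((p.2.2 : ℕ) / N))
  set L : ℝ × ℝ → ℝ × ℝ := fun p => (p.1 + t * p.2, p.2) with hL
  have ht' : ∀ u v x y, ∀ i ≤ N, ∀ j ≤ N, g u v (i / N) ≠ g x y (j / N) →
      (L (g u v (i / N))).1 ≠ (L (g x y (j / N))).1 := by
    intro u v x y i hi j hj h
    exact ht (u, v, ⟨i, by omega⟩) (x, y, ⟨j, by omega⟩) h
  have hdisj : ∀ u v x y, H.Adj u v → H.Adj x y → u ≠ x → u ≠ y → v ≠ x → v ≠ y →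
      ∀ i ≤ N, ∀ j ≤ N, g u v (i / N) ≠ g x y (j / N) := by
    intro u v x y h1 h2 h3 h4 h5 h6 i hi j hj he
    have k : ∀ m : ℕ, m ≤ N → ((m:ℝ) / N) ∈ Set.Icc (0:ℝ) 1 := fun m hm =>
      ⟨by positivity, (div_le_one hNpos).2 (by exact_mod_cast hm)⟩
    exact Set.disjoint_left.1 (hdis u v x y h1 h2 h3 h4 h5 h6)
      ((hg u v h1).2.2.2 _ (k i hi)) (he ▸ (hg x y h2).2.2.2 _ (k j hj))
  have g0 : ∀ u v, H.Adj u v → g u v ((0:ℕ) / N) = f u := by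
    intro u v h; simp [(hg u v h).2.1]
  have g1 : ∀ u v, H.Adj u v → g u v ((N:ℕ) / N) = f v := by
    intro u v h; rw [div_self hNpos.ne']; exact (hg u v h).2.2.1
  refine ⟨fun u v => ordBit (L (f u)).1 (L (f v)).1, fun u x y => ∑ j ∈ Finset.range N,
    belowSeg (L (f u)) (L (g x y (j / N))) (L (g x y ((j + 1 : ℕ) / N))), ?_, ?_⟩
  · intro u v huv
    obtain ⟨u', v', h1, h2, h3, h4, h5⟩ := hsep u v huv
    have h6 := hdisj u u' v v' h1 h2 huv h3 h4 h5 0 (Nat.zero_le _) 0 (Nat.zero_le _)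
    have h7 := ht' u u' v v' 0 (Nat.zero_le _) 0 (Nat.zero_le _) h6
    rw [g0 _ _ h1, g0 _ _ h2] at h7
    unfold ordBit
    rcases lt_or_gt_of_ne h7 with h | h
    · simp [h, h.not_gt]
    · simp [h, h.not_gt]
  · intro u v x y h1 h2 h3 h4 h5 h6
    have hs : ∀ u v, ∀ i < N, (L (g u v (i / N))).1 = (L (g u v ((i + 1 : ℕ) / N))).1 →
        L (g u v (i / N)) = L (g u v ((i + 1 : ℕ) / N)) := by
      intro u v i hi he
      by_contra hne
      exact ht' u v u v i hi.le (i + 1) hi (fun h => hne (by rw [h])) he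
    have := poly_sum (fun i => L (g u v (i / N))) (fun i => L (g x y (i / N))) N hN0
      (hs u v) (hs x y) (fun i hi j hj => ht' u v x y i hi j hj
        (hdisj u v x y h1 h2 h3 h4 h5 h6 i hi j hj)) ?_
    · simp only [g0 _ _ h1, g0 _ _ h2, g1 _ _ h1, g1 _ _ h2] at this
      exact this
    · intro i hi j hj s r hs0 hs1 hr0 hr1 e1 e2
      refine hN u v x y h1 h2 h3 h4 h5 h6 i hi j hj s r hs0 hs1 hr0 hr1 ?_
      simp only [hL] at e1 e2
      have e3 := congrArg (t * ·) e2
      refine Prod.ext ?_ ?_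
      · simp only [Prod.fst_add, Prod.smul_fst, Prod.fst_sub, smul_eq_mul]
        linarith
      · simpa using e2

lemma not_drawn_K5 : ¬ Drawn (⊤ : SimpleGraph (Fin 5)) := by
  intro h
  obtain ⟨o, b, ho, hb⟩ := drawn_cochain _ h (by decide)
  have h2 : (2 : ZMod 2) = 0 := by decide
  have key : (1 : ZMod 2) = 0 := by
    linear_combination hb 0 1 2 3 (by decide) (by decide) (by decide) (by decide) (by decide) (by decide)
      + hb 0 1 2 4 (by decide) (by decide) (by decide) (by decide) (by decide) (by decide)
      + hb 0 1 3 4 (by decide) (by decide) (by decide) (by decide) (by decide) (by decide)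
      + hb 0 2 1 3 (by decide) (by decide) (by decide) (by decide) (by decide) (by decide)
      + hb 0 2 1 4 (by decide) (by decide) (by decide) (by decide) (by decide) (by decide)
      + hb 0 2 3 4 (by decide) (by decide) (by decide) (by decide) (by decide) (by decide)
      + hb 0 3 1 2 (by decide) (by decide) (by decide) (by decide) (by decide) (by decide)
      + hb 0 3 1 4 (by decide) (by decide) (by decide) (by decide) (by decide) (by decide)
      + hb 0 3 2 4 (by decide) (by decide) (by decide) (by decide) (by decide) (by decide)
      + hb 0 4 1 2 (by decide) (by decide) (by decide) (by decide) (by decide) (by decide)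
      + hb 0 4 1 3 (by decide) (by decide) (by decide) (by decide) (by decide) (by decide)
      + hb 0 4 2 3 (by decide) (by decide) (by decide) (by decide) (by decide) (by decide)
      + hb 1 2 3 4 (by decide) (by decide) (by decide) (by decide) (by decide) (by decide)
      + hb 1 3 2 4 (by decide) (by decide) (by decide) (by decide) (by decide) (by decide)
      + hb 1 4 2 3 (by decide) (by decide) (by decide) (by decide) (by decide) (by decide)
      - (2 * ho 1 2 (by decide)
      + 2 * ho 1 3 (by decide)
      + 2 * ho 1 4 (by decide)
      + 3 * ho 2 3 (by decide)
      + 3 * ho 2 4 (by decide)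
      + 3 * ho 3 4 (by decide))
      - (1 * b 0 2 3
      + 1 * b 1 2 3
      + 1 * b 2 0 1
      + 1 * b 3 0 1
      + 1 * b 0 2 4
      + 1 * b 1 2 4
      + 1 * b 4 0 1
      + 1 * b 0 3 4
      + 1 * b 1 3 4
      + 1 * b 0 1 3
      + 1 * b 2 1 3
      + 1 * b 1 0 2
      + 1 * b 3 0 2
      + 1 * b 0 1 4
      + 1 * b 2 1 4
      + 1 * b 4 0 2
      + 1 * b 2 3 4
      + 1 * b 0 1 2
      + 1 * b 3 1 2
      + 1 * b 1 0 3
      + 1 * b 2 0 3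
      + 1 * b 3 1 4
      + 1 * b 4 0 3
      + 1 * b 3 2 4
      + 1 * b 4 1 2
      + 1 * b 1 0 4
      + 1 * b 2 0 4
      + 1 * b 4 1 3
      + 1 * b 3 0 4
      + 1 * b 4 2 3
      + (3) * o 0 1
      + (3) * o 0 2
      + (3) * o 0 3
      + (3) * o 0 4
      + (1) * o 1 2
      + (1) * o 1 3
      + (1) * o 1 4
      + 7) * h2
  exact one_ne_zero key

/-- `K₃,₃` on `Fin 6`, parts given by parity. -/
def K33 : SimpleGraph (Fin 6) where
  Adj i j := i.val % 2 ≠ j.val % 2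
  symm := ⟨fun _ _ h => h.symm⟩
  loopless := ⟨fun _ h => h rfl⟩

instance : DecidableRel K33.Adj := fun i j => inferInstanceAs (Decidable (i.val % 2 ≠ j.val % 2))

lemma not_drawn_K33 : ¬ Drawn K33 := by
  intro h
  obtain ⟨o, b, ho, hb⟩ := drawn_cochain _ h (by decide)
  have h2 : (2 : ZMod 2) = 0 := by decide
  have key : (1 : ZMod 2) = 0 := by
    linear_combination hb 0 1 2 3 (by decide) (by decide) (by decide) (by decide) (by decide) (by decide)
      + hb 0 1 2 5 (by decide) (by decide) (by decide) (by decide) (by decide) (by decide)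
      + hb 0 1 3 4 (by decide) (by decide) (by decide) (by decide) (by decide) (by decide)
      + hb 0 1 4 5 (by decide) (by decide) (by decide) (by decide) (by decide) (by decide)
      + hb 0 3 1 2 (by decide) (by decide) (by decide) (by decide) (by decide) (by decide)
      + hb 0 3 1 4 (by decide) (by decide) (by decide) (by decide) (by decide) (by decide)
      + hb 0 3 2 5 (by decide) (by decide) (by decide) (by decide) (by decide) (by decide)
      + hb 0 3 4 5 (by decide) (by decide) (by decide) (by decide) (by decide) (by decide)
      + hb 0 5 1 2 (by decide) (by decide) (by decide) (by decide) (by decide) (by decide)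
      + hb 0 5 1 4 (by decide) (by decide) (by decide) (by decide) (by decide) (by decide)
      + hb 0 5 2 3 (by decide) (by decide) (by decide) (by decide) (by decide) (by decide)
      + hb 0 5 3 4 (by decide) (by decide) (by decide) (by decide) (by decide) (by decide)
      + hb 1 2 3 4 (by decide) (by decide) (by decide) (by decide) (by decide) (by decide)
      + hb 1 2 4 5 (by decide) (by decide) (by decide) (by decide) (by decide) (by decide)
      + hb 1 4 2 3 (by decide) (by decide) (by decide) (by decide) (by decide) (by decide)
      + hb 1 4 2 5 (by decide) (by decide) (by decide) (by decide) (by decide) (by decide)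
      + hb 2 3 4 5 (by decide) (by decide) (by decide) (by decide) (by decide) (by decide)
      + hb 2 5 3 4 (by decide) (by decide) (by decide) (by decide) (by decide) (by decide)
      - (2 * ho 1 3 (by decide)
      + 2 * ho 1 5 (by decide)
      + 2 * ho 2 3 (by decide)
      + 2 * ho 2 4 (by decide)
      + 2 * ho 2 5 (by decide)
      + 1 * ho 3 4 (by decide)
      + 3 * ho 3 5 (by decide)
      + 3 * ho 4 5 (by decide))
      - (1 * b 0 2 3
      + 1 * b 1 2 3
      + 1 * b 2 0 1
      + 1 * b 3 0 1
      + 1 * b 0 2 5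
      + 1 * b 1 2 5
      + 1 * b 5 0 1
      + 1 * b 0 3 4
      + 1 * b 1 3 4
      + 1 * b 4 0 1
      + 1 * b 0 4 5
      + 1 * b 1 4 5
      + 1 * b 0 1 2
      + 1 * b 3 1 2
      + 1 * b 1 0 3
      + 1 * b 2 0 3
      + 1 * b 0 1 4
      + 1 * b 3 1 4
      + 1 * b 4 0 3
      + 1 * b 3 2 5
      + 1 * b 5 0 3
      + 1 * b 3 4 5
      + 1 * b 5 1 2
      + 1 * b 1 0 5
      + 1 * b 2 0 5
      + 1 * b 5 1 4
      + 1 * b 4 0 5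
      + 1 * b 5 2 3
      + 1 * b 3 0 5
      + 1 * b 5 3 4
      + 1 * b 2 3 4
      + 1 * b 4 1 2
      + 1 * b 2 4 5
      + 1 * b 4 2 3
      + 1 * b 2 1 4
      + 1 * b 4 2 5
      + (2) * o 0 1
      + (3) * o 0 2
      + (2) * o 0 3
      + (3) * o 0 4
      + (2) * o 0 5
      + (2) * o 1 2
      + (1) * o 1 3
      + (2) * o 1 4
      + (1) * o 1 5
      + (1) * o 2 4
      + (1) * o 3 4
      + (-1) * o 4 5
      + 8) * h2
  exact one_ne_zero key

end RbMatch

/-! ### Operations on drawn graphs -/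
namespace RbMatch
open Classical

lemma joinedIn_walk {W : Type*} {H : SimpleGraph W} {f : W → ℝ × ℝ} {S : W → W → Set (ℝ × ℝ)}
    (hS : ∀ u v, H.Adj u v → JoinedIn (S u v) (f u) (f v)) {a b : W} (p : H.Walk a b)
    (T : Set (ℝ × ℝ)) (hT : ∀ x ∈ p.support, ∀ y ∈ p.support, H.Adj x y → S x y ⊆ T)
    (ha : f a ∈ T) : JoinedIn T (f a) (f b) := by
  induction p with
  | nil => exact JoinedIn.refl ha
  | @cons u v w h p ih =>
    have h1 : JoinedIn T (f u) (f v) :=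
      (hS u v h).mono (hT u (by simp) v (by simp) h)
    exact h1.trans (ih (fun x hx y hy => hT x (by simp [hx]) y (by simp [hy])) h1.target_mem)

/-- General pattern lemma. -/
lemma drawn_pattern {W W' : Type*} {H : SimpleGraph W} (hD : Drawn H) (H' : SimpleGraph W')
    (g : W' → W) (hg : Function.Injective g) (X : W' → W' → Set W)
    (hw : ∀ u v, H'.Adj u v → ∃ p : H.Walk (g u) (g v), ∀ z ∈ p.support, z ∈ X u v)
    (hX : ∀ u v x y, H'.Adj u v → H'.Adj x y → u ≠ x → u ≠ y → v ≠ x → v ≠ y →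
      Disjoint (X u v) (X x y)) : Drawn H' := by
  obtain ⟨f, S, hS, hdis⟩ := hD
  refine ⟨fun u => f (g u), fun u v => {z | ∃ x ∈ X u v, ∃ y ∈ X u v, H.Adj x y ∧ z ∈ S x y},
    ?_, ?_⟩
  · intro u v huv
    obtain ⟨p, hp⟩ := hw u v huv
    have hT : ∀ x ∈ p.support, ∀ y ∈ p.support, H.Adj x y →
        S x y ⊆ {z | ∃ x ∈ X u v, ∃ y ∈ X u v, H.Adj x y ∧ z ∈ S x y} :=
      fun x hx y hy hxy z hz => ⟨x, hp x hx, y, hp y hy, hxy, hz⟩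
    apply joinedIn_walk hS p _ hT
    have hne : g u ≠ g v := fun h => huv.ne (hg h)
    generalize g u = a at p hne hT
    cases p with
    | nil => exact absurd rfl hne
    | @cons _ w _ h q => exact hT a (by simp) w (by simp) h (hS a w h).source_mem
  · intro u v x y h1 h2 h3 h4 h5 h6
    have hd := Set.disjoint_left.1 (hX u v x y h1 h2 h3 h4 h5 h6)
    rw [Set.disjoint_left]
    rintro z ⟨a, ha, b, hb, hab, hz⟩ ⟨c, hc, d, hd', hcd, hz'⟩
    refine Set.disjoint_left.1 (hdis a b c d hab hcd ?_ ?_ ?_ ?_) hz hz'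
    · rintro rfl; exact hd ha hc
    · rintro rfl; exact hd ha hd'
    · rintro rfl; exact hd hb hc
    · rintro rfl; exact hd hb hd'

lemma Drawn.mono {W : Type*} {H H' : SimpleGraph W} (hD : Drawn H) (h : H' ≤ H) : Drawn H' := by
  obtain ⟨f, S, hS, hdis⟩ := hD
  exact ⟨f, S, fun u v huv => hS u v (h huv), fun u v x y h1 h2 => hdis u v x y (h h1) (h h2)⟩

/-- At most one intermediate vertex on every new edge. -/
lemma drawn_mid {W W' : Type*} {H : SimpleGraph W} (hD : Drawn H) (H' : SimpleGraph W')
    (g : W' → W) (hg : Function.Injective g) (X : W' → W' → Set W)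
    (hw : ∀ u v, H'.Adj u v → g u ∈ X u v ∧ g v ∈ X u v ∧ (H.Adj (g u) (g v) ∨
      ∃ m ∈ X u v, H.Adj (g u) m ∧ H.Adj m (g v)))
    (hX : ∀ u v x y, H'.Adj u v → H'.Adj x y → u ≠ x → u ≠ y → v ≠ x → v ≠ y →
      Disjoint (X u v) (X x y)) : Drawn H' := by
  refine drawn_pattern hD H' g hg X (fun u v huv => ?_) hX
  obtain ⟨h1, h2, h3 | ⟨m, hm, h3, h4⟩⟩ := hw u v huv
  · refine ⟨SimpleGraph.Walk.cons h3 SimpleGraph.Walk.nil, ?_⟩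
    intro z hz
    simp at hz
    rcases hz with rfl | rfl <;> assumption
  · refine ⟨SimpleGraph.Walk.cons h3 (SimpleGraph.Walk.cons h4 SimpleGraph.Walk.nil), ?_⟩
    intro z hz
    simp at hz
    rcases hz with rfl | rfl | rfl <;> assumption

/-- Contraction of the edge `uv` onto `u`; `v` becomes isolated. -/
def contr {W : Type*} (H : SimpleGraph W) (u v : W) : SimpleGraph W where
  Adj x y := x ≠ v ∧ y ≠ v ∧ x ≠ y ∧ (H.Adj x y ∨ (x = u ∧ H.Adj v y) ∨ (y = u ∧ H.Adj v x))
  symm := ⟨fun x y ⟨h1, h2, h3, h4⟩ => ⟨h2, h1, h3.symm, by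
    rcases h4 with h | h | h
    · exact Or.inl h.symm
    · exact Or.inr (Or.inr h)
    · exact Or.inr (Or.inl h)⟩⟩
  loopless := ⟨fun x h => h.2.2.1 rfl⟩

lemma drawn_contr {W : Type*} {H : SimpleGraph W} (hD : Drawn H) {u v : W} (huv : H.Adj u v) :
    Drawn (contr H u v) := by
  refine drawn_mid hD _ id Function.injective_id
    (fun x y => {z | z = x ∨ z = y ∨ ((x = u ∨ y = u) ∧ z = v)}) ?_ ?_
  · rintro x y ⟨h1, h2, h3, h4⟩
    refine ⟨Or.inl rfl, Or.inr (Or.inl rfl), ?_⟩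
    rcases h4 with h | ⟨rfl, h⟩ | ⟨rfl, h⟩
    · exact Or.inl h
    · exact Or.inr ⟨v, by simp, huv, h⟩
    · exact Or.inr ⟨v, by simp, h.symm, huv.symm⟩
  · rintro a b x y ⟨h1, h2, -, -⟩ ⟨k1, k2, -, -⟩ h3 h4 h5 h6
    rw [Set.disjoint_left]
    rintro z hz hz'
    simp only [Set.mem_ofPred_eq] at hz hz'
    grind

/-- The planar embedding gives a drawing. -/
lemma drawn_of_planar {V : Type*} (G : SimpleGraph V) (h : G.IsPlanar) : Drawn G := by
  obtain ⟨f, γ, hf, hc, hi, he, hv, hd⟩ := h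
  refine ⟨f, fun u v => {z | ∃ h : G.Adj u v, ∃ t ∈ Set.Icc (0:ℝ) 1, z = γ ⟨s(u, v), h⟩ t}, ?_, ?_⟩
  · intro u v huv
    obtain ⟨a, b, h1, h2, h3⟩ := he ⟨s(u, v), huv⟩
    have hj : JoinedIn {z | ∃ h : G.Adj u v, ∃ t ∈ Set.Icc (0:ℝ) 1, z = γ ⟨s(u, v), h⟩ t}
        (f a) (f b) := by
      refine JoinedIn.ofLine (hc ⟨s(u, v), huv⟩) h2 h3 ?_
      rintro _ ⟨t, ht, rfl⟩
      exact ⟨huv, t, ht, rfl⟩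
    simp only [Sym2.eq_iff] at h1
    rcases h1 with ⟨rfl, rfl⟩ | ⟨rfl, rfl⟩
    · exact hj
    · exact hj.symm
  · intro u v x y h1 h2 h3 h4 h5 h6
    rw [Set.disjoint_left]
    rintro z ⟨k1, t, ht, hz⟩ ⟨k2, t', ht', hz'⟩
    have ends : ∀ (u v : V) (k : G.Adj u v) (t : ℝ), t ∈ Set.Icc (0:ℝ) 1 →
        t ∈ Set.Ioo (0:ℝ) 1 ∨ γ ⟨s(u, v), k⟩ t = f u ∨ γ ⟨s(u, v), k⟩ t = f v := by
      intro u v k t ht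
      obtain ⟨a, b, e1, e2, e3⟩ := he ⟨s(u, v), k⟩
      simp only [Sym2.eq_iff] at e1
      rcases eq_or_lt_of_le ht.1 with h | h
      · right
        rw [← h, e2]
        rcases e1 with ⟨rfl, rfl⟩ | ⟨rfl, rfl⟩ <;> simp
      · rcases eq_or_lt_of_le ht.2 with h' | h'
        · right
          rw [h', e3]
          rcases e1 with ⟨rfl, rfl⟩ | ⟨rfl, rfl⟩ <;> simp
        · exact Or.inl ⟨h, h'⟩
    have hee : γ ⟨s(u, v), k1⟩ t = γ ⟨s(x, y), k2⟩ t' := hz.symm.trans hz'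
    have hne : (⟨s(u, v), k1⟩ : G.edgeSet) ≠ ⟨s(x, y), k2⟩ := by
      intro h
      have := congrArg Subtype.val h
      simp only [Sym2.eq_iff] at this
      tauto
    rcases ends u v k1 t ht with p | p | p <;> rcases ends x y k2 t' ht' with q | q | q
    · exact hd _ _ hne t p t' q hee
    · exact hv _ t p x (hee.trans q)
    · exact hv _ t p y (hee.trans q)
    · exact hv _ t' q u (hee.symm.trans p)
    · exact h3 (hf (p.symm.trans (hee.trans q)))
    · exact h4 (hf (p.symm.trans (hee.trans q)))
    · exact hv _ t' q v (hee.symm.trans p)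
    · exact h5 (hf (p.symm.trans (hee.trans q)))
    · exact h6 (hf (p.symm.trans (hee.trans q)))

/-- A `K₅` with one edge (that between `a` and `c`) possibly subdivided by `b`. -/
lemma no_K5_pattern {W : Type*} {H : SimpleGraph W} (hD : Drawn H) (v h a c d m : W)
    (h1 : H.Adj v h) (h2 : H.Adj v a) (h3 : H.Adj v c) (h4 : H.Adj v d)
    (h5 : H.Adj h a) (h6 : H.Adj h c) (h7 : H.Adj h d) (h8 : H.Adj a d) (h9 : H.Adj c d)
    (hm : m ≠ v ∧ m ≠ h ∧ m ≠ d) (hac : a ≠ c)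
    (h10 : H.Adj a c ∨ (H.Adj a m ∧ H.Adj m c)) : False := by
  have hinj : Function.Injective ![v, h, d, a, c] := by
    intro i j hij
    have := h1.ne; have := h2.ne; have := h3.ne; have := h4.ne; have := h5.ne
    have := h6.ne; have := h7.ne; have := h8.ne; have := h9.ne
    fin_cases i <;> fin_cases j <;> simp_all
  apply not_drawn_K5
  have hlow : ∀ i : Fin 5, ¬ 3 ≤ i.val → m ≠ ![v, h, d, a, c] i := by
    intro i hi
    fin_cases i <;> simp_all
  refine drawn_mid hD _ ![v, h, d, a, c] hinj
    (fun i j => {z | z = ![v, h, d, a, c] i ∨ z = ![v, h, d, a, c] j ∨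
      (z = m ∧ 3 ≤ i.val ∧ 3 ≤ j.val)}) ?_ ?_
  · intro i j hij
    refine ⟨Or.inl rfl, Or.inr (Or.inl rfl), ?_⟩
    have hij' : i ≠ j := hij.ne
    by_cases h33 : 3 ≤ i.val ∧ 3 ≤ j.val
    · rcases h10 with h10 | ⟨h10, h11⟩
      · left
        fin_cases i <;> fin_cases j <;> simp_all [SimpleGraph.adj_comm]
      · right
        refine ⟨m, Or.inr (Or.inr ⟨rfl, h33⟩), ?_⟩
        have h10' := h10.symm
        have h11' := h11.symm
        fin_cases i <;> fin_cases j <;> simp_all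
    · left
      have := h1.symm; have := h2.symm; have := h3.symm; have := h4.symm; have := h5.symm
      have := h6.symm; have := h7.symm; have := h8.symm; have := h9.symm
      fin_cases i <;> fin_cases j <;> first | (exact absurd rfl hij') | assumption | (exfalso; simp at h33)
  · intro i j x y hij hxy e1 e2 e3 e4
    have hij' : i ≠ j := hij.ne
    have hxy' : x ≠ y := hxy.ne
    rw [Set.disjoint_left]
    rintro z (rfl | rfl | ⟨rfl, p1, p2⟩) (q | q | ⟨q, q1, q2⟩)
    · exact e1 (hinj q)
    · exact e2 (hinj q)
    · exact hlow i (by omega) q.symm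
    · exact e3 (hinj q)
    · exact e4 (hinj q)
    · exact hlow j (by omega) q.symm
    · exact hlow x (by omega) q
    · exact hlow y (by omega) q
    · omega

end RbMatch

/-! ### The edge bound `e ≤ 3n - 6` -/
namespace RbMatch
open Classical Finset

variable {W : Type*} [Fintype W]

lemma contr_card {H : SimpleGraph W} {u v : W} (huv : H.Adj u v) :
    #H.edgeFinset ≤ #(contr H u v).edgeFinset + 1 + #(H.neighborFinset v ∩ H.neighborFinset u) := by
  have h1 := H.card_edgeFinset_deleteIncidenceSet v
  have h0 : H.degree v ≤ #H.edgeFinset := H.degree_le_card_edgeFinset v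
  set P := (H.neighborFinset v \ H.neighborFinset u).erase u with hP
  have hPc : #P + 1 + #(H.neighborFinset v ∩ H.neighborFinset u) = H.degree v := by
    have hu : u ∈ H.neighborFinset v \ H.neighborFinset u := by simp [huv.symm]
    have := Finset.card_erase_add_one hu
    rw [← hP] at this
    have h3 := Finset.card_sdiff_add_card_inter (H.neighborFinset v) (H.neighborFinset u)
    rw [H.card_neighborFinset_eq_degree] at h3
    omega
  have hsub : (H.deleteIncidenceSet v).edgeFinset ∪ P.image (fun w => s(u, w)) ⊆
      (contr H u v).edgeFinset := by
    intro e he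
    rw [Finset.mem_union] at he
    rw [SimpleGraph.mem_edgeFinset]
    rcases he with he | he
    · rw [SimpleGraph.mem_edgeFinset] at he
      induction e using Sym2.ind with
      | _ x y =>
        rw [SimpleGraph.mem_edgeSet, SimpleGraph.deleteIncidenceSet_adj] at he
        exact ⟨he.2.1, he.2.2, he.1.ne, Or.inl he.1⟩
    · rw [Finset.mem_image] at he
      obtain ⟨w, hw, rfl⟩ := he
      simp only [hP, Finset.mem_erase, Finset.mem_sdiff, SimpleGraph.mem_neighborFinset] at hw
      exact ⟨huv.ne, hw.2.1.ne.symm, hw.1.symm, Or.inr (Or.inl ⟨rfl, hw.2.1⟩)⟩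
  have hdisj : Disjoint (H.deleteIncidenceSet v).edgeFinset (P.image (fun w => s(u, w))) := by
    rw [Finset.disjoint_left]
    intro e he he'
    rw [Finset.mem_image] at he'
    obtain ⟨w, hw, rfl⟩ := he'
    rw [SimpleGraph.mem_edgeFinset, SimpleGraph.mem_edgeSet,
      SimpleGraph.deleteIncidenceSet_adj] at he
    simp only [hP, Finset.mem_erase, Finset.mem_sdiff, SimpleGraph.mem_neighborFinset] at hw
    exact hw.2.2 he.1
  have hcard := Finset.card_le_card hsub
  rw [Finset.card_union_of_disjoint hdisj, Finset.card_image_of_injective] at hcard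
  · omega
  · intro a b hab
    simp only [Sym2.eq_iff] at hab
    grind

lemma sum_deg {H : SimpleGraph W} {A : Finset W} (hA : ∀ x y, H.Adj x y → x ∈ A) :
    ∑ v ∈ A, H.degree v = 2 * #H.edgeFinset := by
  rw [← H.sum_degrees_eq_twice_card_edges]
  refine Finset.sum_subset (Finset.subset_univ _) fun v _ hv => ?_
  rw [← H.card_neighborFinset_eq_degree, Finset.card_eq_zero, Finset.eq_empty_iff_forall_notMem]
  intro w hw
  exact hv (hA v w ((H.mem_neighborFinset _ _).1 hw))

lemma exists_sub_card (H : SimpleGraph W) {k : ℕ} (hk : k ≤ #H.edgeFinset) :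
    ∃ H' : SimpleGraph W, H' ≤ H ∧ #H'.edgeFinset = k := by
  obtain ⟨t, ht, htc⟩ := Finset.exists_subset_card_eq hk
  have ht' : (t : Set (Sym2 W)) ⊆ H.edgeSet := by
    intro e he; exact SimpleGraph.mem_edgeFinset.1 (ht he)
  have hes : (SimpleGraph.fromEdgeSet (t : Set (Sym2 W))).edgeSet = t := by
    rw [SimpleGraph.edgeSet_fromEdgeSet, sdiff_eq_left, Set.disjoint_left]
    intro e he hd
    exact H.not_isDiag_of_mem_edgeSet (ht' he) hd
  obtain ⟨K, hK⟩ : ∃ K : SimpleGraph W, K.edgeSet = t := ⟨_, hes⟩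
  refine ⟨K, ?_, ?_⟩
  · rw [← SimpleGraph.edgeSet_subset_edgeSet, hK]; exact ht'
  · rw [← htc]
    congr 1
    ext e
    rw [SimpleGraph.mem_edgeFinset, hK, Finset.mem_coe]

lemma local_K5 {H : SimpleGraph W} (hD : Drawn H) (v : W) (h4 : 4 ≤ H.degree v)
    (h5 : H.degree v ≤ 5)
    (hc : ∀ w, H.Adj v w → 3 ≤ #(H.neighborFinset v ∩ H.neighborFinset w)) : False := by
  set N := H.neighborFinset v with hN
  have hNc : #N = H.degree v := H.card_neighborFinset_eq_degree v
  have hadj : ∀ w ∈ N, H.Adj v w := fun w hw => (H.mem_neighborFinset _ _).1 hw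
  by_cases hcl : ∀ x ∈ N, ∀ y ∈ N, x ≠ y → H.Adj x y
  · obtain ⟨t, ht, htc⟩ := Finset.exists_subset_card_eq (show 4 ≤ #N by omega)
    obtain ⟨a, ha⟩ := Finset.card_pos.1 (show 0 < #t by omega)
    have hc3 : #(t.erase a) = 3 := by rw [Finset.card_erase_of_mem ha, htc]
    obtain ⟨x, y, z, hxy, hxz, hyz, he⟩ := Finset.card_eq_three.1 hc3
    have hx : x ∈ t.erase a := by simp [he]
    have hy : y ∈ t.erase a := by simp [he]
    have hz : z ∈ t.erase a := by simp [he]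
    rw [Finset.mem_erase] at hx hy hz
    have ha' := ht ha
    have hx' := ht hx.2
    have hy' := ht hy.2
    have hz' := ht hz.2
    exact no_K5_pattern hD v a x y z x (hadj _ ha') (hadj _ hx') (hadj _ hy') (hadj _ hz')
      (hcl _ ha' _ hx' hx.1.symm) (hcl _ ha' _ hy' hy.1.symm) (hcl _ ha' _ hz' hz.1.symm)
      (hcl _ hx' _ hz' hxz) (hcl _ hy' _ hz' hyz)
      ⟨(hadj _ hx').ne.symm, hx.1, hxz⟩ hxy (Or.inl (hcl _ hx' _ hy' hxy))
  · push Not at hcl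
    obtain ⟨x, hx, y, hy, hxy, hna⟩ := hcl
    have hR : #((N.erase x).erase y) = H.degree v - 2 := by
      rw [Finset.card_erase_of_mem (by simp [hy, hxy.symm]), Finset.card_erase_of_mem hx, hNc]
      omega
    have sub : ∀ a b : W, ¬ H.Adj a b → N ∩ H.neighborFinset a ⊆ (N.erase a).erase b := by
      intro a b hab w hw
      simp only [Finset.mem_inter, SimpleGraph.mem_neighborFinset, Finset.mem_erase] at hw ⊢
      refine ⟨?_, hw.2.ne.symm, hw.1⟩
      rintro rfl
      exact hab hw.2
    have sx := sub x y hna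
    have sy := sub y x (fun h => hna h.symm)
    rw [Finset.erase_right_comm] at sy
    have cx := hc x (hadj x hx)
    have cy := hc y (hadj y hy)
    have d5 : H.degree v = 5 := by
      have := Finset.card_le_card sx
      omega
    have ex := Finset.eq_of_subset_of_card_le sx (by omega)
    have ey := Finset.eq_of_subset_of_card_le sy (by omega)
    obtain ⟨p, q, r, hpq, hpr, hqr, he⟩ := Finset.card_eq_three.1 (show #((N.erase x).erase y) = 3 by omega)
    have mem : ∀ z, z ∈ (N.erase x).erase y → z ∈ N ∧ z ≠ x ∧ z ≠ y ∧ H.Adj x z ∧ H.Adj y z := by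
      intro z hz
      have h1 := ex ▸ hz
      have h2 := ey ▸ hz
      simp only [Finset.mem_inter, SimpleGraph.mem_neighborFinset, Finset.mem_erase] at h1 h2 hz
      exact ⟨hz.2.2, hz.2.1, hz.1, h1.2, h2.2⟩
    have mp := mem p (by simp [he])
    have mq := mem q (by simp [he])
    have mr := mem r (by simp [he])
    have fin : ∀ p q r : W, p ∈ N ∧ p ≠ x ∧ p ≠ y ∧ H.Adj x p ∧ H.Adj y p →
        q ∈ N ∧ q ≠ x ∧ q ≠ y ∧ H.Adj x q ∧ H.Adj y q →
        r ∈ N ∧ r ≠ x ∧ r ≠ y ∧ H.Adj x r ∧ H.Adj y r → p ≠ r → q ≠ r → H.Adj p q → False := by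
      intro p q r mp mq mr hpr hqr hadj'
      exact no_K5_pattern hD v p x y q r (hadj _ mp.1) (hadj _ hx) (hadj _ hy) (hadj _ mq.1)
        mp.2.2.2.1.symm mp.2.2.2.2.symm hadj' mq.2.2.2.1 mq.2.2.2.2
        ⟨(hadj _ mr.1).ne.symm, hpr.symm, hqr.symm⟩ hxy (Or.inr ⟨mr.2.2.2.1, mr.2.2.2.2.symm⟩)
    have cp := hc p (hadj p mp.1)
    by_cases hpq' : H.Adj p q
    · exact fin p q r mp mq mr hpr hqr hpq'
    by_cases hpr' : H.Adj p r
    · exact fin p r q mp mr mq hpq hqr.symm hpr'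
    have : N ∩ H.neighborFinset p ⊆ {x, y} := by
      intro w hw
      simp only [Finset.mem_inter, SimpleGraph.mem_neighborFinset] at hw
      by_contra hcon
      simp only [Finset.mem_insert, Finset.mem_singleton, not_or] at hcon
      have hw' : w ∈ (N.erase x).erase y := by simp [hcon, hw.1]
      rw [he] at hw'
      simp only [Finset.mem_insert, Finset.mem_singleton] at hw'
      rcases hw' with rfl | rfl | rfl
      · exact hw.2.ne rfl
      · exact hpq' hw.2
      · exact hpr' hw.2
    have := (Finset.card_le_card this).trans Finset.card_le_two
    omega

lemma edge_bound : ∀ (m : ℕ) (A : Finset W) (H : SimpleGraph W), #A = m → 3 ≤ m → Drawn H →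
    (∀ x y, H.Adj x y → x ∈ A) → #H.edgeFinset ≤ 3 * m - 6 := by
  intro m
  induction m with
  | zero => intros; omega
  | succ m ih =>
    intro A H hAc hm hD hA
    by_contra hcon
    push Not at hcon
    have hsmall : 5 ≤ m + 1 := by
      by_contra hlt
      have hle : ∑ v ∈ A, H.degree v ≤ ∑ v ∈ A, m := by
        refine Finset.sum_le_sum fun v hv => ?_
        have : H.neighborFinset v ⊆ A.erase v := by
          intro w hw
          rw [SimpleGraph.mem_neighborFinset] at hw
          exact Finset.mem_erase.2 ⟨hw.ne.symm, hA w v hw.symm⟩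
        have := Finset.card_le_card this
        rw [Finset.card_erase_of_mem hv, H.card_neighborFinset_eq_degree, hAc] at this
        omega
      rw [sum_deg hA, Finset.sum_const, smul_eq_mul, hAc] at hle
      have : m = 2 ∨ m = 3 := by omega
      rcases this with rfl | rfl <;> omega
    obtain ⟨K, hKH, hKc⟩ := exists_sub_card H (show 3 * (m + 1) - 5 ≤ #H.edgeFinset by omega)
    have hKD := hD.mono hKH
    have hKA : ∀ x y, K.Adj x y → x ∈ A := fun x y h => hA x y (hKH h)
    have hdeg : ∀ v ∈ A, 4 ≤ K.degree v := by
      intro v hv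
      by_contra hlt
      obtain ⟨L, hL⟩ : ∃ L : SimpleGraph W, L = K.deleteIncidenceSet v := ⟨_, rfl⟩
      have h1 : #L.edgeFinset = #K.edgeFinset - K.degree v := by
        subst hL
        convert K.card_edgeFinset_deleteIncidenceSet v
      have := ih (A.erase v) L
        (by rw [Finset.card_erase_of_mem hv, hAc]; rfl) (by omega)
        (hKD.mono (hL ▸ K.deleteIncidenceSet_le v)) (by
          intro x y hxy
          rw [hL, SimpleGraph.deleteIncidenceSet_adj] at hxy
          exact Finset.mem_erase.2 ⟨hxy.2.1, hKA x y hxy.1⟩)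
      omega
    have hcom : ∀ v u, K.Adj v u → 3 ≤ #(K.neighborFinset v ∩ K.neighborFinset u) := by
      intro v u hvu
      by_contra hlt
      have h1 := contr_card hvu.symm
      have hv := hKA v u hvu
      have := ih (A.erase v) (contr K u v)
        (by rw [Finset.card_erase_of_mem hv, hAc]; rfl) (by omega)
        (drawn_contr hKD hvu.symm) (by
          rintro x y ⟨h1, h2, h3, h4⟩
          refine Finset.mem_erase.2 ⟨h1, ?_⟩
          rcases h4 with h | ⟨rfl, h⟩ | ⟨rfl, h⟩
          · exact hKA x y h
          · exact hKA x v hvu.symm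
          · exact hKA x v h.symm)
      omega
    have : ∃ v ∈ A, K.degree v < 6 := by
      apply Finset.exists_lt_of_sum_lt
      rw [sum_deg hKA, Finset.sum_const, hAc, smul_eq_mul, hKc]
      omega
    obtain ⟨v, hv, hlt⟩ := this
    exact local_K5 hKD v (hdeg v hv) (by omega) (hcom v)

end RbMatch

/-! ### The triples lemma -/
namespace RbMatch
open Classical Finset

/-- The graph joining pairs that lie in a common triple. -/
def pairGraph {W : Type*} (O : Finset W) (T : W → Finset W) : SimpleGraph W where
  Adj a b := a ≠ b ∧ ∃ v ∈ O, a ∈ T v ∧ b ∈ T v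
  symm := ⟨fun _ _ ⟨h, v, hv, h1, h2⟩ => ⟨h.symm, v, hv, h2, h1⟩⟩
  loopless := ⟨fun _ h => h.1 rfl⟩

/-- The part of `H` inside `Y`. -/
def insideGraph {W : Type*} (H : SimpleGraph W) (Y : Set W) : SimpleGraph W where
  Adj a b := H.Adj a b ∧ a ∈ Y ∧ b ∈ Y
  symm := ⟨fun _ _ ⟨h, h1, h2⟩ => ⟨h.symm, h2, h1⟩⟩
  loopless := ⟨fun _ h => h.1.ne rfl⟩

set_option linter.unusedSectionVars false

variable {W : Type*} [Fintype W]

lemma triples_A {H : SimpleGraph W} (hD : Drawn H) (T : W → Finset W) (U O : Finset W)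
    (hUO : Disjoint U O) (hT : ∀ v ∈ O, T v ⊆ U) (h3 : ∀ v ∈ O, #(T v) = 3)
    (hadj : ∀ v ∈ O, ∀ t ∈ T v, H.Adj v t) (hU : 3 ≤ #U)
    (hA : ∀ a b, a ≠ b → #{v ∈ O | a ∈ T v ∧ b ∈ T v} ≤ 2) : #O + 4 ≤ 2 * #U := by
  have hne : Nonempty W := by
    obtain ⟨x, _⟩ := Finset.card_pos.1 (show 0 < #U by omega)
    exact ⟨x⟩
  have hex : ∀ a b, (pairGraph O T).Adj a b → ∃ v, v ∈ O ∧ a ∈ T v ∧ b ∈ T v := by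
    rintro a b ⟨_, v, hv, h1, h2⟩
    exact ⟨v, hv, h1, h2⟩
  choose! mid hmO hma hmb using hex
  have hd := Finset.disjoint_left.1 hUO
  have hF : Drawn (pairGraph O T) := by
    refine drawn_mid hD _ id Function.injective_id
      (fun a b => {z | z = a ∨ z = b ∨ z = mid a b}) ?_ ?_
    · intro a b hab
      exact ⟨Or.inl rfl, Or.inr (Or.inl rfl), Or.inr ⟨mid a b, Or.inr (Or.inr rfl),
        (hadj _ (hmO a b hab) _ (hma a b hab)).symm, hadj _ (hmO a b hab) _ (hmb a b hab)⟩⟩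
    · intro a b x y hab hxy e1 e2 e3 e4
      have m1 := hmO a b hab
      have m2 := hmO x y hxy
      have ka := hT _ m1 (hma a b hab)
      have kb := hT _ m1 (hmb a b hab)
      have kx := hT _ m2 (hma x y hxy)
      have ky := hT _ m2 (hmb x y hxy)
      rw [Set.disjoint_left]
      rintro z (rfl | rfl | rfl) (q | q | q)
      · exact e1 q
      · exact e2 q
      · exact hd ka (q ▸ m2)
      · exact e3 q
      · exact e4 q
      · exact hd kb (q ▸ m2)
      · exact hd kx (q ▸ m1)
      · exact hd ky (q ▸ m1)
      · have hsub : ({a, b, x, y} : Finset W) ⊆ T (mid a b) := by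
          intro z hz
          simp only [Finset.mem_insert, Finset.mem_singleton] at hz
          rcases hz with rfl | rfl | rfl | rfl
          · exact hma _ _ hab
          · exact hmb _ _ hab
          · rw [q]; exact hma _ _ hxy
          · rw [q]; exact hmb _ _ hxy
        have hc := Finset.card_le_card hsub
        rw [h3 _ m1, Finset.card_insert_of_notMem, Finset.card_insert_of_notMem,
          Finset.card_pair hxy.1] at hc
        · omega
        · simp [e3, e4]
        · simp [hab.1, e1, e2]
  have hb := edge_bound #U U _ rfl hU hF (by
    rintro x y ⟨_, v, hv, h1, _⟩
    exact hT v hv h1)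
  have hdc : #O * 3 ≤ #(pairGraph O T).edgeFinset * 2 := by
    refine Finset.card_mul_le_card_mul (fun v (e : Sym2 W) => ∀ x ∈ e, x ∈ T v) ?_ ?_
    · intro v hv
      obtain ⟨x, y, z, hxy, hxz, hyz, he⟩ := Finset.card_eq_three.1 (h3 v hv)
      have hsub : ({s(x, y), s(x, z), s(y, z)} : Finset (Sym2 W)) ⊆
          bipartiteAbove (fun v (e : Sym2 W) => ∀ x ∈ e, x ∈ T v) (pairGraph O T).edgeFinset v := by
        intro e hee
        simp only [Finset.mem_insert, Finset.mem_singleton] at hee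
        rw [Finset.mem_bipartiteAbove, SimpleGraph.mem_edgeFinset]
        rcases hee with rfl | rfl | rfl
        · exact ⟨⟨hxy, v, hv, by simp [he], by simp [he]⟩, by simp [he]⟩
        · exact ⟨⟨hxz, v, hv, by simp [he], by simp [he]⟩, by simp [he]⟩
        · exact ⟨⟨hyz, v, hv, by simp [he], by simp [he]⟩, by simp [he]⟩
      refine le_trans (le_of_eq ?_) (Finset.card_le_card hsub)
      symm
      rw [Finset.card_eq_three]
      refine ⟨_, _, _, ?_, ?_, ?_, rfl⟩ <;> simp only [ne_eq, Sym2.eq_iff] <;> grind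
    · intro e he
      induction e using Sym2.ind with
      | _ a b =>
        rw [SimpleGraph.mem_edgeFinset] at he
        refine le_trans (Finset.card_le_card ?_) (hA a b he.1)
        intro v hv
        rw [Finset.mem_bipartiteBelow] at hv
        rw [Finset.mem_filter]
        exact ⟨hv.1, hv.2 a (by simp), hv.2 b (by simp)⟩
  omega

lemma no_K33_pattern {H : SimpleGraph W} (hD : Drawn H) (a b c v₁ v₂ v₃ : W) (Y : Set W)
    (hab : a ≠ b) (h12 : v₁ ≠ v₂) (h13 : v₁ ≠ v₃) (h23 : v₂ ≠ v₃)
    (ha1 : H.Adj v₁ a) (ha2 : H.Adj v₂ a) (ha3 : H.Adj v₃ a)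
    (hb1 : H.Adj v₁ b) (hb2 : H.Adj v₂ b) (hb3 : H.Adj v₃ b)
    (ya : a ∉ Y) (yb : b ∉ Y) (y1 : v₁ ∉ Y) (y2 : v₂ ∉ Y) (y3 : v₃ ∉ Y) (yc : c ∈ Y)
    (w1 : ∃ p : H.Walk v₁ c, ∀ z ∈ p.support, z = v₁ ∨ z ∈ Y)
    (w2 : ∃ p : H.Walk v₂ c, ∀ z ∈ p.support, z = v₂ ∨ z ∈ Y)
    (w3 : ∃ p : H.Walk v₃ c, ∀ z ∈ p.support, z = v₃ ∨ z ∈ Y) : False := by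
  apply not_drawn_K33
  have hinj : Function.Injective ![a, v₁, b, v₂, c, v₃] := by
    intro i j hij
    have := ha1.ne; have := ha2.ne; have := ha3.ne; have := hb1.ne; have := hb2.ne
    have := hb3.ne
    have : c ≠ a := fun h => ya (h ▸ yc)
    have : c ≠ b := fun h => yb (h ▸ yc)
    have : c ≠ v₁ := fun h => y1 (h ▸ yc)
    have : c ≠ v₂ := fun h => y2 (h ▸ yc)
    have : c ≠ v₃ := fun h => y3 (h ▸ yc)
    fin_cases i <;> fin_cases j <;> simp_all
  have hY : ∀ i : Fin 6, i ≠ 4 → ![a, v₁, b, v₂, c, v₃] i ∉ Y := by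
    intro i hi
    fin_cases i <;> simp_all
  have one : ∀ u v (X : Set W), H.Adj u v → u ∈ X → v ∈ X →
      ∃ p : H.Walk u v, ∀ z ∈ p.support, z ∈ X := by
    intro u v X h hu hv
    refine ⟨SimpleGraph.Walk.cons h SimpleGraph.Walk.nil, ?_⟩
    intro z hz
    simp at hz
    rcases hz with rfl | rfl <;> assumption
  refine drawn_pattern hD K33 ![a, v₁, b, v₂, c, v₃] hinj
    (fun i j => {z | z = ![a, v₁, b, v₂, c, v₃] i ∨ z = ![a, v₁, b, v₂, c, v₃] j ∨
      ((i = 4 ∨ j = 4) ∧ z ∈ Y)}) ?_ ?_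
  · have key : ∀ i j : Fin 6, i.val % 2 = 1 → j.val % 2 = 0 →
        ∃ p : H.Walk (![a, v₁, b, v₂, c, v₃] i) (![a, v₁, b, v₂, c, v₃] j), ∀ z ∈ p.support,
          z = ![a, v₁, b, v₂, c, v₃] i ∨ z = ![a, v₁, b, v₂, c, v₃] j ∨ (j = 4 ∧ z ∈ Y) := by
      intro i j hi hj
      have hi' : i = 1 ∨ i = 3 ∨ i = 5 := by omega
      have hj' : j = 0 ∨ j = 2 ∨ j = 4 := by omega
      rcases hj' with rfl | rfl | rfl
      · refine one _ _ {z | _} ?_ (Or.inl rfl) (Or.inr (Or.inl rfl))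
        rcases hi' with rfl | rfl | rfl <;> assumption
      · refine one _ _ {z | _} ?_ (Or.inl rfl) (Or.inr (Or.inl rfl))
        rcases hi' with rfl | rfl | rfl <;> assumption
      · rcases hi' with rfl | rfl | rfl
        · obtain ⟨p, hp⟩ := w1
          exact ⟨p, fun z hz => (hp z hz).imp id fun h => Or.inr ⟨rfl, h⟩⟩
        · obtain ⟨p, hp⟩ := w2
          exact ⟨p, fun z hz => (hp z hz).imp id fun h => Or.inr ⟨rfl, h⟩⟩
        · obtain ⟨p, hp⟩ := w3
          exact ⟨p, fun z hz => (hp z hz).imp id fun h => Or.inr ⟨rfl, h⟩⟩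
    intro i j hij
    have hij' : i.val % 2 ≠ j.val % 2 := hij
    rcases Nat.mod_two_eq_zero_or_one i.val with h | h
    · obtain ⟨p, hp⟩ := key j i (by omega) h
      refine ⟨p.reverse, fun z hz => ?_⟩
      rw [SimpleGraph.Walk.support_reverse, List.mem_reverse] at hz
      rcases hp z hz with h | h | h
      · exact Or.inr (Or.inl h)
      · exact Or.inl h
      · exact Or.inr (Or.inr ⟨Or.inl h.1, h.2⟩)
    · obtain ⟨p, hp⟩ := key i j h (by omega)
      refine ⟨p, fun z hz => ?_⟩
      rcases hp z hz with h | h | h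
      · exact Or.inl h
      · exact Or.inr (Or.inl h)
      · exact Or.inr (Or.inr ⟨Or.inr h.1, h.2⟩)
  · intro i j x y hij hxy e1 e2 e3 e4
    rw [Set.disjoint_left]
    rintro z (rfl | rfl | ⟨p, p1⟩) (q | q | ⟨q, q1⟩)
    · exact e1 (hinj q)
    · exact e2 (hinj q)
    · exact hY i (by omega) q1
    · exact e3 (hinj q)
    · exact e4 (hinj q)
    · exact hY j (by omega) q1
    · exact hY x (by omega) (q ▸ p1)
    · exact hY y (by omega) (q ▸ p1)
    · omega

lemma inside_walk {H : SimpleGraph W} {Y : Set W} {x y : W}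
    (h : (insideGraph H Y).Reachable x y) (hx : x ∈ Y) :
    ∃ p : H.Walk x y, ∀ z ∈ p.support, z ∈ Y := by
  obtain ⟨p⟩ := h
  induction p with
  | nil => exact ⟨SimpleGraph.Walk.nil, by simpa using hx⟩
  | cons h p ih =>
    obtain ⟨q, hq⟩ := ih h.2.2
    refine ⟨SimpleGraph.Walk.cons h.1 q, ?_⟩
    intro z hz
    rw [SimpleGraph.Walk.support_cons, List.mem_cons] at hz
    rcases hz with rfl | hz
    · exact hx
    · exact hq z hz

lemma triple_third {s : Finset W} (h : #s = 3) {a b : W} (ha : a ∈ s) (hb : b ∈ s)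
    (hab : a ≠ b) : ∃ c, c ∈ s ∧ c ≠ a ∧ c ≠ b ∧ ∀ z ∈ s, z = a ∨ z = b ∨ z = c := by
  have h1 : #((s.erase a).erase b) = 1 := by
    rw [Finset.card_erase_of_mem (Finset.mem_erase.2 ⟨hab.symm, hb⟩), Finset.card_erase_of_mem ha, h]
  obtain ⟨c, hc⟩ := Finset.card_eq_one.1 h1
  have hm : ∀ z, z ∈ (s.erase a).erase b ↔ z = c := by
    intro z; rw [hc, Finset.mem_singleton]
  simp only [Finset.mem_erase] at hm
  have hcc := (hm c).2 rfl
  refine ⟨c, hcc.2.2, hcc.2.1, hcc.1, fun z hz => ?_⟩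
  have := (hm z).1
  tauto

lemma triples {H : SimpleGraph W} (hD : Drawn H) (T : W → Finset W) : ∀ (m : ℕ) (U O : Finset W),
    #U = m → Disjoint U O → (∀ v ∈ O, T v ⊆ U) → (∀ v ∈ O, #(T v) = 3) →
    (∀ v ∈ O, ∀ t ∈ T v, H.Adj v t) → 3 ≤ #U → #O + 4 ≤ 2 * #U := by
  intro m
  induction m using Nat.strong_induction_on with
  | _ m ih =>
  intro U O hm hUO hT h3 hadj hU
  by_cases hA : ∀ a b, a ≠ b → #{v ∈ O | a ∈ T v ∧ b ∈ T v} ≤ 2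
  · exact triples_A hD T U O hUO hT h3 hadj hU hA
  push Not at hA
  obtain ⟨a, b, hab, hlt⟩ := hA
  obtain ⟨v₁, v₂, v₃, m1, m2, m3, h12, h13, h23⟩ := Finset.two_lt_card_iff.1 hlt
  rw [Finset.mem_filter] at m1 m2 m3
  obtain ⟨o1, a1, b1⟩ := m1
  obtain ⟨o2, a2, b2⟩ := m2
  obtain ⟨o3, a3, b3⟩ := m3
  have hd := Finset.disjoint_left.1 hUO
  have hau := hT _ o1 a1
  have hbu := hT _ o1 b1
  obtain ⟨c₁, t1, ca1, cb1, all1⟩ := triple_third (h3 _ o1) a1 b1 hab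
  obtain ⟨c₂, t2, ca2, cb2, all2⟩ := triple_third (h3 _ o2) a2 b2 hab
  obtain ⟨c₃, t3, ca3, cb3, all3⟩ := triple_third (h3 _ o3) a3 b3 hab
  set Y : Set W := {z | z ≠ a ∧ z ≠ b ∧ z ≠ v₁ ∧ z ≠ v₂ ∧ z ≠ v₃} with hY
  have hUY : ∀ z ∈ U, z ≠ a → z ≠ b → z ∈ Y := by
    intro z hz h1 h2
    refine ⟨h1, h2, ?_, ?_, ?_⟩ <;> rintro rfl <;> exact hd hz (by assumption)
  have u1 := hT _ o1 t1
  have u2 := hT _ o2 t2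
  have u3 := hT _ o3 t3
  have yc1 := hUY c₁ u1 ca1 cb1
  have yc2 := hUY c₂ u2 ca2 cb2
  have yc3 := hUY c₃ u3 ca3 cb3
  set J := insideGraph H Y with hJ
  by_cases hr : J.Reachable c₁ c₂ ∧ J.Reachable c₁ c₃
  · exfalso
    have ext : ∀ v c, H.Adj v c → c ∈ Y → J.Reachable c₁ c →
        ∃ p : H.Walk v c₁, ∀ z ∈ p.support, z = v ∨ z ∈ Y := by
      intro v c hvc hc hr
      obtain ⟨p, hp⟩ := inside_walk hr.symm hc
      refine ⟨SimpleGraph.Walk.cons hvc p, fun z hz => ?_⟩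
      rw [SimpleGraph.Walk.support_cons, List.mem_cons] at hz
      exact hz.imp id (hp z)
    exact no_K33_pattern hD a b c₁ v₁ v₂ v₃ Y hab h12 h13 h23
      (hadj _ o1 _ a1) (hadj _ o2 _ a2) (hadj _ o3 _ a3)
      (hadj _ o1 _ b1) (hadj _ o2 _ b2) (hadj _ o3 _ b3)
      (fun h => h.1 rfl) (fun h => h.2.1 rfl) (fun h => h.2.2.1 rfl) (fun h => h.2.2.2.1 rfl)
      (fun h => h.2.2.2.2 rfl) yc1
      (ext _ _ (hadj _ o1 _ t1) yc1 (SimpleGraph.Reachable.refl _))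
      (ext _ _ (hadj _ o2 _ t2) yc2 hr.1) (ext _ _ (hadj _ o3 _ t3) yc3 hr.2)
  obtain ⟨d, hdu, hda, hdb, hdr⟩ : ∃ d ∈ U, d ≠ a ∧ d ≠ b ∧ ¬ J.Reachable c₁ d := by
    by_cases h : J.Reachable c₁ c₂
    · exact ⟨c₃, u3, ca3, cb3, fun h' => hr ⟨h, h'⟩⟩
    · exact ⟨c₂, u2, ca2, cb2, h⟩
  set C := U.filter (fun x => x ≠ a ∧ x ≠ b ∧ J.Reachable c₁ x) with hC
  have hCm : ∀ x, x ∈ C ↔ x ∈ U ∧ x ≠ a ∧ x ≠ b ∧ J.Reachable c₁ x := by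
    intro x; rw [hC, Finset.mem_filter]
  have hc1C : c₁ ∈ C := (hCm _).2 ⟨u1, ca1, cb1, SimpleGraph.Reachable.refl _⟩
  have hCU : C ⊆ U := Finset.filter_subset _ _
  have haC : a ∉ C := fun h => ((hCm _).1 h).2.1 rfl
  have hbC : b ∉ C := fun h => ((hCm _).1 h).2.2.1 rfl
  have hdC : d ∉ C := fun h => hdr ((hCm _).1 h).2.2.2
  set U1 := insert a (insert b C) with hU1
  have hU1c : #U1 = #C + 2 := by
    rw [hU1, Finset.card_insert_of_notMem (by simp [hab, haC]), Finset.card_insert_of_notMem hbC]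
  have hU2c : #(U \ C) + #C = #U := Finset.card_sdiff_add_card_eq_card hCU
  have hCpos : 0 < #C := Finset.card_pos.2 ⟨_, hc1C⟩
  have hU2 : 3 ≤ #(U \ C) := by
    have : ({a, b, d} : Finset W) ⊆ U \ C := by
      intro z hz
      simp only [Finset.mem_insert, Finset.mem_singleton] at hz
      rw [Finset.mem_sdiff]
      rcases hz with rfl | rfl | rfl <;> constructor <;> assumption
    have h := Finset.card_le_card this
    rwa [Finset.card_eq_three.2 ⟨a, b, d, hab, hda.symm, hdb.symm, rfl⟩] at h
  have hU1sub : U1 ⊆ U := by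
    intro z hz
    simp only [hU1, Finset.mem_insert] at hz
    rcases hz with rfl | rfl | hz
    · exact hau
    · exact hbu
    · exact hCU hz
  have closed : ∀ v ∈ O, ∀ t ∈ T v, t ∈ C → T v ⊆ U1 := by
    intro v hv t ht htC s hs
    have hsU := hT v hv hs
    obtain ⟨q1, q2, q3, q4⟩ := (hCm t).1 htC
    by_cases hsa : s = a
    · simp [hU1, hsa]
    by_cases hsb : s = b
    · simp [hU1, hsb]
    have : s ∈ C := by
      by_cases hst : s = t
      · rwa [hst]
      refine (hCm s).2 ⟨hsU, hsa, hsb, ?_⟩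
      have hvY : v ∈ Y := by
        refine ⟨?_, ?_, ?_, ?_, ?_⟩
        · rintro rfl; exact hd hau hv
        · rintro rfl; exact hd hbu hv
        · rintro rfl
          have := all1 s hs; have := all1 t ht
          grind
        · rintro rfl
          have := all2 s hs; have := all2 t ht
          grind
        · rintro rfl
          have := all3 s hs; have := all3 t ht
          grind
      have j1 : J.Adj t v := ⟨(hadj v hv t ht).symm, hUY t q1 q2 q3, hvY⟩
      have j2 : J.Adj v s := ⟨hadj v hv s hs, hvY, hUY s hsU hsa hsb⟩
      exact q4.trans (j1.reachable.trans j2.reachable)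
    simp [hU1, this]
  have r1 := ih #U1 (by omega) U1 (O.filter fun v => T v ⊆ U1) rfl
    (Finset.disjoint_of_subset_left hU1sub (Finset.disjoint_of_subset_right (Finset.filter_subset _ _) hUO))
    (fun v hv => (Finset.mem_filter.1 hv).2) (fun v hv => h3 v (Finset.mem_filter.1 hv).1)
    (fun v hv => hadj v (Finset.mem_filter.1 hv).1) (by omega)
  have r2 := ih #(U \ C) (by omega) (U \ C) (O.filter fun v => ¬ T v ⊆ U1) rfl
    (Finset.disjoint_of_subset_left Finset.sdiff_subset
      (Finset.disjoint_of_subset_right (Finset.filter_subset _ _) hUO))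
    (fun v hv t ht => by
      rw [Finset.mem_filter] at hv
      exact Finset.mem_sdiff.2 ⟨hT v hv.1 ht, fun h => hv.2 (closed v hv.1 t ht h)⟩)
    (fun v hv => h3 v (Finset.mem_filter.1 hv).1)
    (fun v hv => hadj v (Finset.mem_filter.1 hv).1) hU2
  have hsum := Finset.card_filter_add_card_filter_not (s := O) (fun v => T v ⊆ U1)
  omega

end RbMatch

/-! ### Matchings -/
namespace RbMatch
open Classical Finset

lemma matching_sub {W : Type*} {H : SimpleGraph W} {M M' : Finset (Sym2 W)} {k : ℕ}
    (h : IsMatchingOfSize H M k) (hs : M' ⊆ M) : IsMatchingOfSize H M' #M' :=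
  ⟨rfl, fun _ he => h.2.1 (hs he), fun e he e' he' => h.2.2 e (hs he) e' (hs he')⟩

lemma matching_insert {W : Type*} {H : SimpleGraph W} {M : Finset (Sym2 W)} {k : ℕ}
    (h : IsMatchingOfSize H M k) {x y : W} (hxy : H.Adj x y) (hx : ∀ e ∈ M, x ∉ e)
    (hy : ∀ e ∈ M, y ∉ e) : IsMatchingOfSize H (insert s(x, y) M) (k + 1) := by
  refine ⟨?_, ?_, ?_⟩
  · rw [Finset.card_insert_of_notMem, h.1]
    intro hm
    exact hx _ hm (by simp)
  · intro e he
    rw [Finset.mem_coe, Finset.mem_insert] at he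
    rcases he with rfl | he
    · exact hxy
    · exact h.2.1 he
  · intro e he e' he' hne v hv hv'
    rw [Finset.mem_insert] at he he'
    rcases he with rfl | he <;> rcases he' with rfl | he'
    · exact hne rfl
    · rw [Sym2.mem_iff] at hv
      rcases hv with rfl | rfl
      · exact hx _ he' hv'
      · exact hy _ he' hv'
    · rw [Sym2.mem_iff] at hv'
      rcases hv' with rfl | rfl
      · exact hx _ he hv
      · exact hy _ he hv
    · exact h.2.2 e he e' he' hne v hv hv'

variable {W : Type*} [Fintype W]

lemma edge_count {H : SimpleGraph W} (hD : Drawn H) (hn : 3 ≤ Fintype.card W) (B : Finset W)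
    (hB : ∀ x, x ∉ B → H.degree x ≤ 2) :
    #H.edgeFinset + 6 ≤ 2 * Fintype.card W + #B ∨
      #H.edgeFinset ≤ 2 * Fintype.card W + 3 := by
  obtain ⟨K, hK⟩ : ∃ K : SimpleGraph W, K = insideGraph H (B : Set W) := ⟨_, rfl⟩
  have hKD : Drawn K := hD.mono (by rw [hK]; exact fun x y h => h.1)
  have hsub : H.edgeFinset ⊆ K.edgeFinset ∪ (Bᶜ).biUnion fun x => H.incidenceFinset x := by
    intro e he
    induction e using Sym2.ind with
    | _ x y =>
    rw [SimpleGraph.mem_edgeFinset, SimpleGraph.mem_edgeSet] at he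
    rw [Finset.mem_union, Finset.mem_biUnion]
    by_cases hx : x ∈ B
    · by_cases hy : y ∈ B
      · left
        rw [SimpleGraph.mem_edgeFinset, SimpleGraph.mem_edgeSet, hK]
        exact ⟨he, hx, hy⟩
      · right
        refine ⟨y, by simpa using hy, ?_⟩
        rw [SimpleGraph.mem_incidenceFinset]
        exact ⟨he, by simp⟩
    · right
      refine ⟨x, by simpa using hx, ?_⟩
      rw [SimpleGraph.mem_incidenceFinset]
      exact ⟨he, by simp⟩
  have h1 := (Finset.card_le_card hsub).trans (Finset.card_union_le _ _)
  have h2 : #((Bᶜ).biUnion fun x => H.incidenceFinset x) ≤ #Bᶜ * 2 := by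
    refine Finset.card_biUnion_le_card_mul _ _ _ fun x hx => ?_
    rw [H.card_incidenceFinset_eq_degree]
    exact hB x (by simpa using hx)
  rw [Finset.card_compl] at h2
  have h3 := Finset.card_le_univ B
  have hKB : ∀ x y, K.Adj x y → x ∈ B := by
    intro x y h
    rw [hK] at h
    exact h.2.1
  by_cases hb : 3 ≤ #B
  · have := edge_bound #B B K rfl hb hKD hKB
    left
    omega
  · obtain ⟨B', hBB, hc⟩ := Finset.exists_superset_card_eq (show #B ≤ 3 by omega) hn
    have := edge_bound 3 B' K hc le_rfl hKD (fun x y h => hBB (hKB x y h))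
    right
    omega

lemma main_bound {H : SimpleGraph W} (hD : Drawn H) (k : ℕ) (hk : 5 ≤ k)
    (hn : 3 ≤ Fintype.card W) (hE : 2 * Fintype.card W + 6 * k - 16 ≤ #H.edgeFinset) :
    ∃ M, IsMatchingOfSize H M k := by
  by_contra hno
  have hlt : ∀ M m, IsMatchingOfSize H M m → m < k := by
    intro M m hM
    by_contra hcon
    obtain ⟨M', hs, hc⟩ := Finset.exists_subset_card_eq (show k ≤ #M by rw [hM.1]; omega)
    exact hno ⟨M', hc ▸ matching_sub hM hs⟩
  obtain ⟨M, hMf, hmax⟩ := Finset.exists_max_image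
    (univ.filter fun M : Finset (Sym2 W) => IsMatchingOfSize H M #M) (fun M => #M)
    ⟨∅, by simp [IsMatchingOfSize]⟩
  have hM : IsMatchingOfSize H M #M := (Finset.mem_filter.1 hMf).2
  have hnu := hlt _ _ hM
  have hmax' : ∀ M' m, IsMatchingOfSize H M' m → m ≤ #M := by
    intro M' m h
    have := hmax M' (by rw [Finset.mem_filter]; exact ⟨Finset.mem_univ _, h.1.symm ▸ h⟩)
    rw [h.1] at this
    exact this
  clear hmax hMf
  set A : Finset W := M.biUnion fun e => e.toFinset with hA
  have hAm : ∀ x, x ∈ A ↔ ∃ e ∈ M, x ∈ e := by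
    intro x; simp [hA]
  have hAc : #A ≤ #M * 2 := by
    refine Finset.card_biUnion_le_card_mul _ _ _ fun e he => ?_
    rw [Sym2.card_toFinset]
    split_ifs <;> omega
  have hout : ∀ x, x ∉ A → ∀ e ∈ M, x ∉ e := fun x hx e he hxe => hx ((hAm x).2 ⟨e, he, hxe⟩)
  have hind : ∀ x y, x ∉ A → y ∉ A → ¬ H.Adj x y := by
    intro x y hx hy hxy
    have := hmax' _ _ (matching_insert hM hxy (hout x hx) (hout y hy))
    omega
  set out : W → Finset W := fun w => univ.filter fun x => H.Adj w x ∧ x ∉ A with hO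
  have hom : ∀ w x, x ∈ out w ↔ H.Adj w x ∧ x ∉ A := by
    intro w x; simp [hO]
  have haug : ∀ a b x y, s(a, b) ∈ M → x ∈ out a → y ∈ out b → x = y := by
    intro a b x y he hx hy
    by_contra hxy
    rw [hom] at hx hy
    have hab : a ≠ b := by
      have : H.Adj a b := hM.2.1 he
      exact this.ne
    have haA : a ∈ A := (hAm a).2 ⟨_, he, by simp⟩
    have hbA : b ∈ A := (hAm b).2 ⟨_, he, by simp⟩
    have h0 := matching_sub hM (Finset.erase_subset s(a, b) M)
    have hin : ∀ z, z ∈ s(a, b) → ∀ e ∈ M.erase s(a, b), z ∉ e := by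
      intro z hz e hee
      rw [Finset.mem_erase] at hee
      exact hM.2.2 _ he e hee.2 hee.1.symm z hz
    have hou : ∀ z, z ∉ A → ∀ e ∈ M.erase s(a, b), z ∉ e := fun z hz e hee =>
      hout z hz e (Finset.mem_of_mem_erase hee)
    have h1 := matching_insert h0 hy.1 (hin b (by simp)) (hou y hy.2)
    have h2 := matching_insert h1 hx.1 (by
      intro e hee
      rw [Finset.mem_insert] at hee
      rcases hee with rfl | hee
      · rw [Sym2.mem_iff]
        rintro (h | h)
        · exact hab h
        · exact hy.2 (h ▸ haA)
      · exact hin a (by simp) e hee) (by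
      intro e hee
      rw [Finset.mem_insert] at hee
      rcases hee with rfl | hee
      · rw [Sym2.mem_iff]
        rintro (h | h)
        · exact hx.2 (h ▸ hbA)
        · exact hxy h
      · exact hou x hx.2 e hee)
    have := hmax' _ _ h2
    rw [Finset.card_erase_of_mem he] at this
    have : 0 < #M := Finset.card_pos.2 ⟨_, he⟩
    omega
  have hex : ∀ e : Sym2 W, ∃ u w : W, e ∈ M → e = s(u, w) ∧ #(out w) ≤ 1 := by
    intro e
    induction e using Sym2.ind with
    | _ a b =>
    by_cases he : s(a, b) ∈ M
    · by_cases h1 : #(out b) ≤ 1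
      · exact ⟨a, b, fun _ => ⟨rfl, h1⟩⟩
      · refine ⟨b, a, fun _ => ⟨Sym2.eq_swap, ?_⟩⟩
        rw [Finset.card_le_one]
        intro x hx x' hx'
        obtain ⟨y, hy⟩ := Finset.card_pos.1 (show 0 < #(out b) by omega)
        rw [haug a b x y he hx hy, haug a b x' y he hx' hy]
    · exact ⟨a, b, fun h => absurd h he⟩
  choose u w huw using hex
  set U := M.image u with hU
  have hUc : #U ≤ #M := Finset.card_image_le
  have hUA : U ⊆ A := by
    intro x hx
    rw [hU, Finset.mem_image] at hx
    obtain ⟨e, he, rfl⟩ := hx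
    refine (hAm _).2 ⟨e, he, ?_⟩
    have h := (huw e he).1
    generalize u e = p at h
    rw [h]
    exact Sym2.mem_mk_left _ _
  set O3 := univ.filter (fun x => x ∉ A ∧ 3 ≤ H.degree x) with hO3
  set O' := univ.filter (fun x => x ∉ A ∧ 3 ≤ #(H.neighborFinset x ∩ U)) with hO'
  have hsub : O3 ⊆ O' ∪ M.biUnion fun e => out (w e) := by
    intro x hx
    rw [hO3, Finset.mem_filter] at hx
    rw [Finset.mem_union]
    by_cases hb : x ∈ M.biUnion fun e => out (w e)
    · exact Or.inr hb
    · left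
      rw [hO', Finset.mem_filter]
      refine ⟨Finset.mem_univ _, hx.2.1, ?_⟩
      have : H.neighborFinset x ⊆ U := by
        intro y hy
        rw [SimpleGraph.mem_neighborFinset] at hy
        have hyA : y ∈ A := by
          by_contra h
          exact hind x y hx.2.1 h hy
        obtain ⟨e, he, hye⟩ := (hAm y).1 hyA
        rw [(huw e he).1, Sym2.mem_iff] at hye
        rcases hye with rfl | rfl
        · exact Finset.mem_image_of_mem _ he
        · exact absurd (Finset.mem_biUnion.2 ⟨e, he, (hom _ _).2 ⟨hy.symm, hx.2.1⟩⟩) hb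
      rw [Finset.inter_eq_left.2 this, H.card_neighborFinset_eq_degree]
      exact hx.2.2
  have hbi : #(M.biUnion fun e => out (w e)) ≤ #M * 1 :=
    Finset.card_biUnion_le_card_mul _ _ _ fun e he => (huw e he).2
  have hO3c := (Finset.card_le_card hsub).trans (Finset.card_union_le _ _)
  have hcnt := edge_count hD hn (A ∪ O3) (by
    intro x hx
    rw [Finset.mem_union, not_or] at hx
    by_contra h
    exact hx.2 (Finset.mem_filter.2 ⟨Finset.mem_univ _, hx.1, by omega⟩))
  have hBc := Finset.card_union_le A O3
  by_cases hU3 : 3 ≤ #U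
  · have hTex : ∀ v, ∃ t : Finset W, v ∈ O' → t ⊆ H.neighborFinset v ∩ U ∧ #t = 3 := by
      intro v
      by_cases hv : v ∈ O'
      · obtain ⟨t, h1, h2⟩ := Finset.exists_subset_card_eq (Finset.mem_filter.1 hv).2.2
        exact ⟨t, fun _ => ⟨h1, h2⟩⟩
      · exact ⟨∅, fun h => absurd h hv⟩
    choose T hT using hTex
    have ht := triples hD T #U U O' rfl (by
      rw [Finset.disjoint_left]
      intro x hx hx'
      exact (Finset.mem_filter.1 hx').2.1 (hUA hx))
      (fun v hv t ht => (Finset.mem_inter.1 ((hT v hv).1 ht)).2) (fun v hv => (hT v hv).2)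
      (fun v hv t ht => (H.mem_neighborFinset _ _).1 (Finset.mem_inter.1 ((hT v hv).1 ht)).1) hU3
    omega
  · have : O' = ∅ := by
      rw [Finset.eq_empty_iff_forall_notMem]
      intro x hx
      have h1 := (Finset.mem_filter.1 hx).2.2
      have h2 := Finset.card_le_card (Finset.inter_subset_right (s₁ := H.neighborFinset x) (s₂ := U))
      omega
    rw [this, Finset.card_empty] at hO3c
    omega

end RbMatch

/-- For all integers `k ≥ 5` and `n ≥ 2k`, `rb(𝒯ₙ, kK₂) ≤ 2n + 6k − 16`: every
edge-coloring of a plane triangulation on `n` vertices using at least `2n + 6k − 16`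
distinct colors contains a rainbow matching of size `k`. -/
theorem rb_planeTriangulation_matching_upper (n k : ℕ) (hk : 5 ≤ k) (hn : 2 * k ≤ n)
    (G : SimpleGraph (Fin n)) (hG : IsPlaneTriangulation G)
    (c : Sym2 (Fin n) → ℕ) (hc : 2 * n + 6 * k - 16 ≤ (c '' G.edgeSet).ncard) :
    HasRainbowMatching G c k := by
  classical
  obtain ⟨s, hs, hbij⟩ := Set.exists_subset_bijOn G.edgeSet c
  obtain ⟨K, hK⟩ : ∃ K : SimpleGraph (Fin n), K.edgeSet = s := by
    refine ⟨SimpleGraph.fromEdgeSet s, ?_⟩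
    rw [SimpleGraph.edgeSet_fromEdgeSet, sdiff_eq_left, Set.disjoint_left]
    intro e he hd
    exact G.not_isDiag_of_mem_edgeSet (hs he) hd
  have hKG : K ≤ G := by
    rw [← SimpleGraph.edgeSet_subset_edgeSet, hK]
    exact hs
  have hcard : K.edgeFinset.card = (c '' G.edgeSet).ncard := by
    rw [← hbij.image_eq, hbij.injOn.ncard_image, ← hK, ← SimpleGraph.coe_edgeFinset,
      Set.ncard_coe_finset]
  have hD := (RbMatch.drawn_of_planar G hG.2.1).mono hKG
  obtain ⟨M, hM⟩ := RbMatch.main_bound hD k hk (by rw [Fintype.card_fin]; omega) (by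
    rw [Fintype.card_fin]
    convert hc)
  refine ⟨M, ⟨hM.1, fun e he => hs (hK ▸ hM.2.1 he), hM.2.2⟩, ?_⟩
  exact hbij.injOn.mono (hK ▸ hM.2.1)
end

section
/- Let k ≥ 3 and n ≥ 2k be integers, and let G be a planar simple graph on n vertices that contains a matching of size k − 1 but contains no matching of size k. Then G has at most 2n + 6k − 16 edges. -/
open scoped unitInterval

namespace PlanarMatch

/-- Continuous logarithm on an interval. -/
lemma exists_log_I (F : I → ℂ) (hF : Continuous F) (h0 : ∀ t, F t ≠ 0) :
    ∃ g : I → ℂ, Continuous g ∧ ∀ t, Complex.exp (g t) = F t := by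
  obtain ⟨Γ, h1, -⟩ := Complex.isCoveringMap_exp.exists_path_lifts
    (⟨fun t => ⟨F t, h0 t⟩, by fun_prop⟩ : C(I, {z : ℂ // z ≠ 0})) (Complex.log (F 0))
    (by ext; simp [Complex.exp_log (h0 0)])
  refine ⟨Γ, Γ.continuous, fun t => ?_⟩
  have := congrFun h1 t
  simpa using congrArg Subtype.val this

/-- Continuous logarithm on a square. -/
lemma exists_log_square (F : I × I → ℂ) (hF : Continuous F) (h0 : ∀ t, F t ≠ 0) :
    ∃ g : I × I → ℂ, Continuous g ∧ ∀ t, Complex.exp (g t) = F t := by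
  obtain ⟨f, hf, hf'⟩ := exists_log_I (fun t => F (0, t)) (by fun_prop) (fun t => h0 _)
  have H0 : ∀ a : I, (⟨fun t => ⟨F t, h0 t⟩, by fun_prop⟩ : C(I × I, {z : ℂ // z ≠ 0})) (0, a) =
      (fun z : ℂ ↦ (⟨_, z.exp_ne_zero⟩ : {z : ℂ // z ≠ 0})) ((⟨f, hf⟩ : C(I, ℂ)) a) := by
    intro a; ext; simp [hf']
  refine ⟨Complex.isCoveringMap_exp.liftHomotopy _ ⟨f, hf⟩ H0, ContinuousMap.continuous _,
    fun t => ?_⟩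
  have := congrFun (Complex.isCoveringMap_exp.liftHomotopy_lifts _ ⟨f, hf⟩ H0) t
  simpa using congrArg Subtype.val this

/-- Two continuous logarithms on the interval have the same total change. -/
lemma log_change_unique (g h : I → ℂ) (hg : Continuous g) (hh : Continuous h)
    (c : ℂ) (H : ∀ t, Complex.exp (g t) = c * Complex.exp (h t)) :
    g 1 - g 0 = h 1 - h 0 := by
  have hc : c ≠ 0 := by
    rintro rfl
    have := H 0
    simp at this
  have H' : ∀ t, Complex.exp (g t) = Complex.exp (h t + Complex.log c) := by
    intro t; rw [Complex.exp_add, Complex.exp_log hc, H, mul_comm]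
  have hcov := Complex.isCoveringMap_exp
  have key := hcov.eq_of_comp_eq (A := I) (g₁ := fun t => g t)
    (g₂ := fun t => h t + Complex.log c + (g 0 - (h 0 + Complex.log c)))
    hg (by fun_prop) (by
      ext t
      simp only [Function.comp]
      have e0 := H' 0
      have e1 : Complex.exp (g 0 - (h 0 + Complex.log c)) = 1 := by
        rw [Complex.exp_sub, e0, div_self (Complex.exp_ne_zero _)]
      rw [Complex.exp_add _ (g 0 - _), e1, mul_one, H']) 0 (by ring)
  have := congrFun key 1
  rw [this]; ring

/-- Total change of the logarithm of `γ - p` along `γ` (junk if `γ` passes through `p`). -/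
noncomputable def logChange (p : ℂ) (γ : C(I, ℂ)) : ℂ :=
  open Classical in
  if h : ∀ t, γ t - p ≠ 0 then
    (exists_log_I (fun t => γ t - p) (by fun_prop) h).choose 1 -
    (exists_log_I (fun t => γ t - p) (by fun_prop) h).choose 0
  else 0

lemma logChange_eq (p : ℂ) (γ : C(I, ℂ)) (g : I → ℂ) (hg : Continuous g) (c : ℂ)
    (hc : c ≠ 0) (H : ∀ t, Complex.exp (g t) = c * (γ t - p)) :
    logChange p γ = g 1 - g 0 := by
  have h : ∀ t, γ t - p ≠ 0 := by
    intro t ht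
    have := H t
    rw [ht] at this
    simp at this
  unfold logChange
  rw [dif_pos h]
  have hs := (exists_log_I (fun t => γ t - p) (by fun_prop) h).choose_spec
  refine log_change_unique _ _ hs.1 hg c⁻¹ fun t => ?_
  rw [hs.2, H]; field_simp

lemma exp_logChange (p : ℂ) (γ : C(I, ℂ)) (h : ∀ t, γ t ≠ p) :
    Complex.exp (logChange p γ) * (γ 0 - p) = γ 1 - p := by
  obtain ⟨g, hg, hg'⟩ := exists_log_I (fun t => γ t - p) (by fun_prop)
    (fun t => sub_ne_zero.2 (h t))
  rw [logChange_eq p γ g hg 1 one_ne_zero (by simpa using hg'), Complex.exp_sub, hg', hg']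
  have : γ 0 - p ≠ 0 := sub_ne_zero.2 (h 0)
  field_simp

lemma square_eq (γ δ : C(I, ℂ)) (h : ∀ s t, γ s ≠ δ t) :
    logChange (δ 0) γ + logChange (γ 1) δ - logChange (δ 1) γ - logChange (γ 0) δ = 0 := by
  obtain ⟨g, hg, hg'⟩ := exists_log_square (fun q => γ q.1 - δ q.2) (by fun_prop)
    (fun q => sub_ne_zero.2 (h _ _))
  rw [logChange_eq (δ 0) γ (fun s => g (s, 0)) (by fun_prop) 1 one_ne_zero (by simp [hg']),
    logChange_eq (δ 1) γ (fun s => g (s, 1)) (by fun_prop) 1 one_ne_zero (by simp [hg']),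
    logChange_eq (γ 0) δ (fun s => g (0, s)) (by fun_prop) (-1) (by simp) (by simp [hg']),
    logChange_eq (γ 1) δ (fun s => g (1, s)) (by fun_prop) (-1) (by simp) (by simp [hg'])]
  ring

/-- A weak drawing: independent edges are realised by disjoint connecting sets. -/
def Good {V : Type*} (G : SimpleGraph V) : Prop :=
  ∃ (p : V → ℂ) (K : V → V → Set ℂ),
    (∀ a b, G.Adj a b → JoinedIn (K a b) (p a) (p b)) ∧
    ∀ a b c d, G.Adj a b → G.Adj c d → a ≠ c → a ≠ d → b ≠ c → b ≠ d →
      Disjoint (K a b) (K c d)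

lemma Good.comap {V W : Type*} {G : SimpleGraph V} {H : SimpleGraph W} (hG : Good G)
    (f : W → V) (hf : Function.Injective f) (h : ∀ a b, H.Adj a b → G.Adj (f a) (f b)) :
    Good H := by
  obtain ⟨p, K, h1, h2⟩ := hG
  refine ⟨fun w => p (f w), fun a b => K (f a) (f b), fun a b hab => h1 _ _ (h _ _ hab), ?_⟩
  intro a b c d hab hcd h3 h4 h5 h6
  exact h2 _ _ _ _ (h _ _ hab) (h _ _ hcd) (hf.ne h3) (hf.ne h4) (hf.ne h5) (hf.ne h6)

lemma Good.mono {V : Type*} {G H : SimpleGraph V} (hG : Good G) (h : H ≤ G) : Good H :=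
  hG.comap id Function.injective_id fun _ _ hab => h hab

/-- sign of an ordered pair -/
def sg {m : ℕ} (a b : Fin m) : ℤ := if b < a then 1 else -1

lemma Good.integers {m : ℕ} {G : SimpleGraph (Fin m)} (hG : Good G) :
    ∃ n : Fin m → Fin m → Fin m → ℤ, ∀ i j k l, G.Adj i j → G.Adj k l →
      i ≠ k → i ≠ l → j ≠ k → j ≠ l →
      sg k j + sg i k + sg j l + sg l i + 2 * (n k i j + n j k l - n l i j - n i k l) = 0 := by
  obtain ⟨p, K, h1, h2⟩ := hG
  have hγ : ∀ i j, ∃ γ : C(I, ℂ), G.Adj i j → γ 0 = p i ∧ γ 1 = p j ∧ ∀ t, γ t ∈ K i j := by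
    intro i j
    by_cases hij : G.Adj i j
    · obtain ⟨γ, hγ⟩ := h1 i j hij
      exact ⟨γ, fun _ => ⟨γ.source, γ.target, hγ⟩⟩
    · exact ⟨.const I 0, fun h => absurd h hij⟩
  choose γ hγ using hγ
  let L : Fin m → Fin m → ℂ := fun i j => if i < j then Complex.log (p j - p i)
    else Complex.log (p i - p j) + Real.pi * Complex.I
  have hL : ∀ i j, p i ≠ p j → Complex.exp (L i j) = p j - p i := by
    intro i j hij
    by_cases h : i < j
    · simp only [L, if_pos h]
      exact Complex.exp_log (sub_ne_zero.2 hij.symm)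
    · simp only [L, if_neg h]
      rw [Complex.exp_add, Complex.exp_log (sub_ne_zero.2 hij), Complex.exp_pi_mul_I]
      ring
  have hLs : ∀ i j, i ≠ j → L i j - L j i = (sg i j : ℂ) * (Real.pi * Complex.I) := by
    intro i j hij
    rcases lt_or_gt_of_ne hij with h | h
    · simp [L, sg, h, h.not_gt]
    · simp [L, sg, h, h.not_gt]
  have hn : ∀ a i j, ∃ n : ℤ, (p a ≠ p i ∧ p a ≠ p j ∧ ∀ t, γ i j t ≠ p a) → G.Adj i j →
      logChange (p a) (γ i j) = L a j - L a i + n * (2 * Real.pi * Complex.I) := by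
    intro a i j
    by_cases H : (p a ≠ p i ∧ p a ≠ p j ∧ ∀ t, γ i j t ≠ p a) ∧ G.Adj i j
    · obtain ⟨⟨H1, H2, H3⟩, H4⟩ := H
      have := exp_logChange (p a) (γ i j) H3
      rw [(hγ i j H4).1, (hγ i j H4).2.1, ← hL _ _ H1, ← hL _ _ H2, ← Complex.exp_add,
        Complex.exp_eq_exp_iff_exists_int] at this
      obtain ⟨n, hn⟩ := this
      exact ⟨n, fun _ _ => by linear_combination hn⟩
    · exact ⟨0, fun h h' => absurd ⟨h, h'⟩ H⟩
  choose n hn using hn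
  refine ⟨n, fun i j k l hij hkl hik hil hjk hjl => ?_⟩
  have hd := Set.disjoint_left.1 (h2 i j k l hij hkl hik hil hjk hjl)
  obtain ⟨a0, a1, a2⟩ := hγ i j hij
  obtain ⟨b0, b1, b2⟩ := hγ k l hkl
  have hne : ∀ s t, γ i j s ≠ γ k l t := fun s t h => hd (a2 s) (h ▸ b2 t)
  have sq := square_eq (γ i j) (γ k l) hne
  have e1 : p i ≠ p k := by have := hne 0 0; rwa [a0, b0] at this
  have e2 : p i ≠ p l := by have := hne 0 1; rwa [a0, b1] at this
  have e3 : p j ≠ p k := by have := hne 1 0; rwa [a1, b0] at this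
  have e4 : p j ≠ p l := by have := hne 1 1; rwa [a1, b1] at this
  rw [a0, a1, b0, b1,
    hn k i j ⟨e1.symm, e3.symm, fun t => by have := hne t 0; rwa [b0] at this⟩ hij,
    hn l i j ⟨e2.symm, e4.symm, fun t => by have := hne t 1; rwa [b1] at this⟩ hij,
    hn j k l ⟨e3, e4, fun t => by have := (hne 1 t).symm; rwa [a1] at this⟩ hkl,
    hn i k l ⟨e1, e2, fun t => by have := (hne 0 t).symm; rwa [a0] at this⟩ hkl] at sq
  have s1 := hLs k j hjk.symm
  have s2 := hLs i k hik
  have s3 := hLs j l hjl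
  have s4 := hLs l i hil.symm
  have fin : (((sg k j + sg i k + sg j l + sg l i +
      2 * (n k i j + n j k l - n l i j - n i k l) : ℤ)) : ℂ) * (Real.pi * Complex.I) = 0 := by
    push_cast
    linear_combination sq - s1 - s2 - s3 - s4
  have hpi : (Real.pi * Complex.I : ℂ) ≠ 0 := by
    simp [Real.pi_ne_zero]
  exact_mod_cast (mul_eq_zero.1 fin).resolve_right hpi

lemma not_good_K5 : ¬ Good (⊤ : SimpleGraph (Fin 5)) := by
  intro h
  obtain ⟨n, hn⟩ := h.integers
  have H : ∀ i j k l : Fin 5, i ≠ j → k ≠ l → i ≠ k → i ≠ l → j ≠ k → j ≠ l →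
      sg k j + sg i k + sg j l + sg l i + 2 * (n k i j + n j k l - n l i j - n i k l) = 0 :=
    fun i j k l h1 h2 => hn i j k l (by simpa using h1) (by simpa using h2)
  have h1 := H 0 1 2 3 (by decide) (by decide) (by decide) (by decide) (by decide) (by decide)
  have h2 := H 0 1 2 4 (by decide) (by decide) (by decide) (by decide) (by decide) (by decide)
  have h3 := H 0 1 3 4 (by decide) (by decide) (by decide) (by decide) (by decide) (by decide)
  have h4 := H 0 2 1 3 (by decide) (by decide) (by decide) (by decide) (by decide) (by decide)
  have h5 := H 0 2 1 4 (by decide) (by decide) (by decide) (by decide) (by decide) (by decide)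
  have h6 := H 0 2 3 4 (by decide) (by decide) (by decide) (by decide) (by decide) (by decide)
  have h7 := H 0 3 1 2 (by decide) (by decide) (by decide) (by decide) (by decide) (by decide)
  have h8 := H 0 3 1 4 (by decide) (by decide) (by decide) (by decide) (by decide) (by decide)
  have h9 := H 0 3 2 4 (by decide) (by decide) (by decide) (by decide) (by decide) (by decide)
  have h10 := H 0 4 1 2 (by decide) (by decide) (by decide) (by decide) (by decide) (by decide)
  have h11 := H 0 4 1 3 (by decide) (by decide) (by decide) (by decide) (by decide) (by decide)
  have h12 := H 0 4 2 3 (by decide) (by decide) (by decide) (by decide) (by decide) (by decide)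
  have h13 := H 1 2 3 4 (by decide) (by decide) (by decide) (by decide) (by decide) (by decide)
  have h14 := H 1 3 2 4 (by decide) (by decide) (by decide) (by decide) (by decide) (by decide)
  have h15 := H 1 4 2 3 (by decide) (by decide) (by decide) (by decide) (by decide) (by decide)
  clear H hn h
  simp [sg] at h1 h2 h3 h4 h5 h6 h7 h8 h9 h10 h11 h12 h13 h14 h15
  omega

/-- The graph `K_{3,3}` with sides `{0,1,2}` and `{3,4,5}`. -/
def K33 : SimpleGraph (Fin 6) where
  Adj a b := (a < 3 ∧ 3 ≤ b) ∨ (b < 3 ∧ 3 ≤ a)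
  symm := ⟨fun _ _ h => h.symm⟩
  loopless := ⟨fun a h => by omega⟩

lemma not_good_K33 : ¬ Good K33 := by
  intro h
  obtain ⟨n, hn⟩ := h.integers
  have H : ∀ i j k l : Fin 6, i < 3 → 3 ≤ j → k < 3 → 3 ≤ l → i ≠ k → j ≠ l →
      sg k j + sg i k + sg j l + sg l i + 2 * (n k i j + n j k l - n l i j - n i k l) = 0 :=
    fun i j k l h1 h2 h3 h4 h5 h6 => hn i j k l (Or.inl ⟨h1, h2⟩) (Or.inl ⟨h3, h4⟩) h5
      (by omega) (by omega) h6
  have h1 := H 0 3 1 4 (by decide) (by decide) (by decide) (by decide) (by decide) (by decide)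
  have h2 := H 0 3 1 5 (by decide) (by decide) (by decide) (by decide) (by decide) (by decide)
  have h3 := H 0 4 1 3 (by decide) (by decide) (by decide) (by decide) (by decide) (by decide)
  have h4 := H 0 4 1 5 (by decide) (by decide) (by decide) (by decide) (by decide) (by decide)
  have h5 := H 0 5 1 3 (by decide) (by decide) (by decide) (by decide) (by decide) (by decide)
  have h6 := H 0 5 1 4 (by decide) (by decide) (by decide) (by decide) (by decide) (by decide)
  have h7 := H 0 3 2 4 (by decide) (by decide) (by decide) (by decide) (by decide) (by decide)
  have h8 := H 0 3 2 5 (by decide) (by decide) (by decide) (by decide) (by decide) (by decide)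
  have h9 := H 0 4 2 3 (by decide) (by decide) (by decide) (by decide) (by decide) (by decide)
  have h10 := H 0 4 2 5 (by decide) (by decide) (by decide) (by decide) (by decide) (by decide)
  have h11 := H 0 5 2 3 (by decide) (by decide) (by decide) (by decide) (by decide) (by decide)
  have h12 := H 0 5 2 4 (by decide) (by decide) (by decide) (by decide) (by decide) (by decide)
  have h13 := H 1 3 2 4 (by decide) (by decide) (by decide) (by decide) (by decide) (by decide)
  have h14 := H 1 3 2 5 (by decide) (by decide) (by decide) (by decide) (by decide) (by decide)
  have h15 := H 1 4 2 3 (by decide) (by decide) (by decide) (by decide) (by decide) (by decide)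
  have h16 := H 1 4 2 5 (by decide) (by decide) (by decide) (by decide) (by decide) (by decide)
  have h17 := H 1 5 2 3 (by decide) (by decide) (by decide) (by decide) (by decide) (by decide)
  have h18 := H 1 5 2 4 (by decide) (by decide) (by decide) (by decide) (by decide) (by decide)
  clear H hn h
  simp [sg] at h1 h2 h3 h4 h5 h6 h7 h8 h9 h10 h11 h12 h13 h14 h15 h16 h17 h18
  omega

end PlanarMatch

namespace PlanarMatch
section comb
open scoped Classical
set_option linter.unusedSectionVars false
variable {V : Type*} [DecidableEq V]

lemma Good.false_of_clique {G : SimpleGraph V} (hG : Good G) (a b c d e : V)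
    (h1 : G.Adj a b) (h2 : G.Adj a c) (h3 : G.Adj a d) (h4 : G.Adj a e) (h5 : G.Adj b c)
    (h6 : G.Adj b d) (h7 : G.Adj b e) (h8 : G.Adj c d) (h9 : G.Adj c e) (h10 : G.Adj d e) :
    False := by
  have key : ∀ i j : Fin 5, i ≠ j → G.Adj (![a, b, c, d, e] i) (![a, b, c, d, e] j) := by
    intro i j hij
    fin_cases i <;> fin_cases j <;>
      first
      | exact absurd rfl hij
      | (simp; assumption)
      | (simp; apply SimpleGraph.Adj.symm; assumption)
  refine not_good_K5 (hG.comap ![a, b, c, d, e] ?_ ?_)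
  · intro i j hij
    by_contra hne
    exact (key i j hne).ne hij
  · intro i j hij
    exact key i j hij.ne

lemma Good.false_of_K33 {G : SimpleGraph V} (hG : Good G) (a b c u v w : V)
    (hab : a ≠ b) (hac : a ≠ c) (hbc : b ≠ c) (huv : u ≠ v) (huw : u ≠ w) (hvw : v ≠ w)
    (h1 : G.Adj a u) (h2 : G.Adj a v) (h3 : G.Adj a w)
    (h4 : G.Adj b u) (h5 : G.Adj b v) (h6 : G.Adj b w)
    (h7 : G.Adj c u) (h8 : G.Adj c v) (h9 : G.Adj c w) : False := by
  have key : ∀ i j : Fin 6, i < 3 → 3 ≤ j →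
      G.Adj (![a, b, c, u, v, w] i) (![a, b, c, u, v, w] j) := by
    intro i j hi hj
    fin_cases i <;> fin_cases j <;>
      first
      | (exfalso; revert hi hj; decide)
      | (simp; assumption)
  refine not_good_K33 (hG.comap ![a, b, c, u, v, w] ?_ ?_)
  · intro i j hij
    rcases lt_or_ge i 3 with hi | hi <;> rcases lt_or_ge j 3 with hj | hj
    · fin_cases i <;> fin_cases j <;> simp_all
    · exact absurd hij (key i j hi hj).ne
    · exact absurd hij.symm (key j i hj hi).ne
    · fin_cases i <;> fin_cases j <;> simp_all
  · rintro i j (⟨hi, hj⟩ | ⟨hi, hj⟩)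
    · exact key i j hi hj
    · exact (key j i hi hj).symm

/-- Contract `y` into `x`; `y` becomes isolated. -/
def contr (G : SimpleGraph V) (x y : V) : SimpleGraph V where
  Adj a b := a ≠ b ∧ a ≠ y ∧ b ≠ y ∧ (G.Adj a b ∨ (a = x ∧ G.Adj y b) ∨ (b = x ∧ G.Adj y a))
  symm := ⟨fun a b h => ⟨h.1.symm, h.2.2.1, h.2.1, by
    rcases h.2.2.2 with h | h | h
    · exact Or.inl h.symm
    · exact Or.inr (Or.inr h)
    · exact Or.inr (Or.inl h)⟩⟩
  loopless := ⟨fun a h => h.1 rfl⟩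

lemma Good.contr {G : SimpleGraph V} (hG : Good G) {x y : V} (hxy : G.Adj x y) :
    Good (contr G x y) := by
  obtain ⟨p, K, h1, h2⟩ := hG
  refine ⟨p, fun a b => if G.Adj a b then K a b else if a = x then K x y ∪ K y b
    else K a y ∪ K y x, ?_, ?_⟩
  · rintro a b ⟨hab, hay, hby, h⟩
    by_cases hadj : G.Adj a b
    · simp only [if_pos hadj]; exact h1 a b hadj
    · simp only [if_neg hadj]
      rcases h with h | ⟨rfl, h⟩ | ⟨rfl, h⟩
      · exact absurd h hadj
      · rw [if_pos rfl]
        exact ((h1 _ _ hxy).mono Set.subset_union_left).trans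
          ((h1 _ _ h).mono Set.subset_union_right)
      · rw [if_neg hab]
        exact ((h1 _ _ h.symm).mono Set.subset_union_left).trans
          ((h1 _ _ hxy.symm).mono Set.subset_union_right)
  · rintro a b c d ⟨hab, hay, hby, h⟩ ⟨hcd, hcy, hdy, h'⟩ hac had hbc hbd
    have hyx := hxy.symm
    by_cases e1 : G.Adj a b <;> by_cases e2 : G.Adj c d
    · simp only [if_pos e1, if_pos e2]
      exact h2 _ _ _ _ e1 e2 hac had hbc hbd
    · simp only [if_pos e1, if_neg e2]
      rcases h' with h' | ⟨rfl, h'⟩ | ⟨rfl, h'⟩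
      · exact absurd h' e2
      · rw [if_pos rfl, Set.disjoint_union_right]
        exact ⟨h2 _ _ _ _ e1 hxy hac hay hbc hby, h2 _ _ _ _ e1 h' hay had hby hbd⟩
      · rw [if_neg hcd, Set.disjoint_union_right]
        exact ⟨h2 _ _ _ _ e1 h'.symm hac hay hbc hby, h2 _ _ _ _ e1 hyx hay had hby hbd⟩
    · simp only [if_neg e1, if_pos e2]
      rcases h with h | ⟨rfl, h⟩ | ⟨rfl, h⟩
      · exact absurd h e1
      · rw [if_pos rfl, Set.disjoint_union_left]
        exact ⟨h2 _ _ _ _ hxy e2 hac had hcy.symm hdy.symm,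
          h2 _ _ _ _ h e2 hcy.symm hdy.symm hbc hbd⟩
      · rw [if_neg hab, Set.disjoint_union_left]
        exact ⟨h2 _ _ _ _ h.symm e2 hac had hcy.symm hdy.symm,
          h2 _ _ _ _ hyx e2 hcy.symm hdy.symm hbc hbd⟩
    · exfalso
      rcases h with h | ⟨rfl, h⟩ | ⟨rfl, h⟩ <;> rcases h' with h' | ⟨rfl, h'⟩ | ⟨rfl, h'⟩ <;>
        first | exact e1 h | exact e2 h' | contradiction

/-- Degree of `v` into `S`. -/
noncomputable def dg (G : SimpleGraph V) (S : Finset V) (v : V) : ℕ := (S.filter (G.Adj v)).card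

/-- Number of common neighbours in `S`. -/
noncomputable def cd (G : SimpleGraph V) (S : Finset V) (x y : V) : ℕ :=
  (S.filter (fun w => G.Adj x w ∧ G.Adj y w)).card

/-- Twice the number of edges inside `S`. -/
noncomputable def E2 (G : SimpleGraph V) (S : Finset V) : ℕ := ∑ v ∈ S, dg G S v

/-- Ordered adjacent pairs in `S`. -/
noncomputable def prs (G : SimpleGraph V) (S : Finset V) : Finset (V × V) :=
  (S ×ˢ S).filter (fun q => G.Adj q.1 q.2)

lemma mem_prs {G : SimpleGraph V} {S : Finset V} {a b : V} :
    (a, b) ∈ prs G S ↔ a ∈ S ∧ b ∈ S ∧ G.Adj a b := by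
  simp [prs, and_assoc]

lemma E2_eq (G : SimpleGraph V) (S : Finset V) : E2 G S = (prs G S).card := by
  unfold E2 prs dg
  rw [Finset.card_filter, Finset.sum_product]
  simp only [Finset.card_filter]

lemma dg_split (G : SimpleGraph V) (A B : Finset V) (h : Disjoint A B) (v : V) :
    dg G (A ∪ B) v = dg G A v + dg G B v := by
  unfold dg
  rw [Finset.filter_union, Finset.card_union_of_disjoint]
  exact Finset.disjoint_filter_filter h

lemma dg_mono (G : SimpleGraph V) {A B : Finset V} (h : A ⊆ B) (v : V) : dg G A v ≤ dg G B v :=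
  Finset.card_le_card (Finset.filter_subset_filter _ h)

lemma sum_dg_comm (G : SimpleGraph V) (A B : Finset V) :
    ∑ v ∈ A, dg G B v = ∑ v ∈ B, dg G A v := by
  unfold dg
  simp only [Finset.card_filter]
  rw [Finset.sum_comm]
  simp [G.adj_comm]

lemma dg_erase_self (G : SimpleGraph V) (S : Finset V) (v : V) : dg G (S.erase v) v = dg G S v := by
  unfold dg
  congr 1
  ext w
  simp only [Finset.mem_filter, Finset.mem_erase]
  exact ⟨fun h => ⟨h.1.2, h.2⟩, fun h => ⟨⟨h.2.ne', h.1⟩, h.2⟩⟩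

lemma dg_le (G : SimpleGraph V) (S : Finset V) {v : V} (hv : v ∈ S) : dg G S v + 1 ≤ S.card := by
  rw [← dg_erase_self, ← Finset.card_erase_add_one hv]
  exact Nat.add_le_add_right (Finset.card_filter_le _ _) 1

lemma E2_union (G : SimpleGraph V) (A B : Finset V) (h : Disjoint A B) :
    E2 G (A ∪ B) = E2 G A + E2 G B + 2 * ∑ v ∈ A, dg G B v := by
  unfold E2
  rw [Finset.sum_union h]
  simp only [dg_split G A B h, Finset.sum_add_distrib]
  rw [sum_dg_comm G B A]
  ring

lemma E2_erase (G : SimpleGraph V) (S : Finset V) {y : V} (hy : y ∈ S) :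
    E2 G S = E2 G (S.erase y) + 2 * dg G S y := by
  have h : Disjoint {y} (S.erase y) := by simp
  have := E2_union G {y} (S.erase y) h
  rw [← Finset.insert_eq, Finset.insert_erase hy] at this
  rw [this, Finset.sum_singleton, dg_erase_self]
  have : E2 G {y} = 0 := by simp [E2, dg]
  omega

lemma E2_contr (G : SimpleGraph V) (S : Finset V) {x y : V} (hx : x ∈ S) (hy : y ∈ S)
    (hxy : G.Adj x y) :
    E2 G S ≤ E2 (contr G x y) (S.erase y) + 2 + 2 * cd G S x y := by
  rw [E2_erase G S hy]
  set D : Finset V := (S.erase x).filter (fun b => G.Adj y b ∧ ¬ G.Adj x b) with hD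
  have h1 : dg G S y = 1 + cd G S x y + D.card := by
    unfold dg cd
    have : S.filter (G.Adj y) = {x} ∪ S.filter (fun w => G.Adj x w ∧ G.Adj y w) ∪ D := by
      ext w
      simp only [hD, Finset.mem_filter, Finset.mem_union, Finset.mem_singleton, Finset.mem_erase]
      constructor
      · rintro ⟨h, h'⟩
        by_cases hw : w = x
        · simp [hw]
        · by_cases hw' : G.Adj x w <;> simp [*]
      · rintro ((rfl | h) | h)
        · exact ⟨hx, hxy.symm⟩
        · exact ⟨h.1, h.2.2⟩
        · exact ⟨h.1.2, h.2.1⟩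
    rw [this, Finset.card_union_of_disjoint, Finset.card_union_of_disjoint, Finset.card_singleton]
    · simp
    · rw [Finset.disjoint_left]
      simp only [hD, Finset.mem_filter, Finset.mem_union, Finset.mem_singleton, Finset.mem_erase]
      rintro w (rfl | h) h'
      · exact h'.1.1 rfl
      · exact h'.2.2 h.2.1
  have h2 : E2 G (S.erase y) + 2 * D.card ≤ E2 (contr G x y) (S.erase y) := by
    rw [E2_eq, E2_eq]
    have i1 : (D.image fun b => (x, b)).card = D.card :=
      Finset.card_image_of_injective _ (fun a b h => by simpa using h)
    have i2 : (D.image fun b => (b, x)).card = D.card :=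
      Finset.card_image_of_injective _ (fun a b h => by simpa using h)
    have hmem : ∀ b ∈ D, b ∈ S ∧ b ≠ x ∧ b ≠ y ∧ G.Adj y b ∧ ¬ G.Adj x b := by
      intro b hb
      simp only [hD, Finset.mem_filter, Finset.mem_erase] at hb
      exact ⟨hb.1.2, hb.1.1, hb.2.1.ne', hb.2.1, hb.2.2⟩
    have d1 : Disjoint (prs G (S.erase y)) (D.image fun b => (x, b)) := by
      rw [Finset.disjoint_right]
      intro q hq hq'
      obtain ⟨b, hb, rfl⟩ := Finset.mem_image.1 hq
      exact (hmem b hb).2.2.2.2 (mem_prs.1 hq').2.2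
    have d2 : Disjoint (prs G (S.erase y) ∪ D.image fun b => (x, b)) (D.image fun b => (b, x)) := by
      rw [Finset.disjoint_right]
      intro q hq hq'
      obtain ⟨b, hb, rfl⟩ := Finset.mem_image.1 hq
      rcases Finset.mem_union.1 hq' with h | h
      · exact (hmem b hb).2.2.2.2 (mem_prs.1 h).2.2.symm
      · obtain ⟨c, hc, h⟩ := Finset.mem_image.1 h
        simp only [Prod.mk.injEq] at h
        exact (hmem b hb).2.1 h.1.symm
    calc _ = (prs G (S.erase y) ∪ (D.image fun b => (x, b)) ∪ (D.image fun b => (b, x))).card := by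
          rw [Finset.card_union_of_disjoint d2, Finset.card_union_of_disjoint d1, i1, i2]; ring
      _ ≤ _ := by
          apply Finset.card_le_card
          rintro ⟨a, b⟩ hq
          rw [mem_prs]
          have hxS : x ∈ S.erase y := Finset.mem_erase.2 ⟨hxy.ne, hx⟩
          rcases Finset.mem_union.1 hq with hq | hq
          · rcases Finset.mem_union.1 hq with hq | hq
            · obtain ⟨p1, p2, p3⟩ := mem_prs.1 hq
              exact ⟨p1, p2, p3.ne, (Finset.mem_erase.1 p1).1, (Finset.mem_erase.1 p2).1, Or.inl p3⟩
            · obtain ⟨c, hc, h⟩ := Finset.mem_image.1 hq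
              simp only [Prod.mk.injEq] at h
              obtain ⟨rfl, rfl⟩ := h
              obtain ⟨q1, q2, q3, q4, q5⟩ := hmem _ hc
              exact ⟨hxS, Finset.mem_erase.2 ⟨q3, q1⟩, q2.symm, hxy.ne, q3,
                Or.inr (Or.inl ⟨rfl, q4⟩)⟩
          · obtain ⟨c, hc, h⟩ := Finset.mem_image.1 hq
            simp only [Prod.mk.injEq] at h
            obtain ⟨rfl, rfl⟩ := h
            obtain ⟨q1, q2, q3, q4, q5⟩ := hmem _ hc
            exact ⟨Finset.mem_erase.2 ⟨q3, q1⟩, hxS, q2, q3, hxy.ne,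
              Or.inr (Or.inr ⟨rfl, q4⟩)⟩
  omega

lemma exists_delete (G : SimpleGraph V) (S : Finset V) (h : 0 < E2 G S) :
    ∃ G' : SimpleGraph V, G' ≤ G ∧ E2 G' S < E2 G S ∧ E2 G S ≤ E2 G' S + 2 := by
  rw [E2_eq, Finset.card_pos] at h
  obtain ⟨⟨a, b⟩, hab⟩ := h
  refine ⟨G.deleteEdges {s(a, b)}, G.deleteEdges_le _, ?_, ?_⟩
  · rw [E2_eq, E2_eq]
    apply Finset.card_lt_card
    rw [Finset.ssubset_iff_of_subset]
    · exact ⟨(a, b), hab, fun h => by simp [mem_prs] at h⟩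
    · rintro ⟨c, d⟩ h
      rw [mem_prs] at h ⊢
      exact ⟨h.1, h.2.1, G.deleteEdges_le _ h.2.2⟩
  · rw [E2_eq, E2_eq]
    have : prs G S ⊆ prs (G.deleteEdges {s(a, b)}) S ∪ {(a, b), (b, a)} := by
      rintro ⟨c, d⟩ h
      rw [mem_prs] at h
      simp only [Finset.mem_union, mem_prs, SimpleGraph.deleteEdges_adj, Set.mem_singleton_iff,
        Sym2.eq_iff, Finset.mem_insert, Finset.mem_singleton, Prod.mk.injEq]
      tauto
    refine (Finset.card_le_card this).trans ((Finset.card_union_le _ _).trans ?_)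
    exact Nat.add_le_add_left (Finset.card_le_two) _

end comb
end PlanarMatch

namespace PlanarMatch
section mader
open scoped Classical
set_option linter.unusedSectionVars false
variable {V : Type*} [DecidableEq V]

lemma mader_local {G : SimpleGraph V} (hG : Good G) (v : V) (A : Finset V)
    (hA : ∀ a ∈ A, G.Adj v a) (hc : A.card = 4 ∨ A.card = 5)
    (h3 : ∀ a ∈ A, 3 ≤ dg G A a) : False := by
  -- a vertex of `A` misses few others
  have Q4 : A.card = 4 → ∀ a ∈ A, ∀ b ∈ A, a ≠ b → G.Adj a b := by
    intro hA4 a ha b hb hab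
    by_contra hn
    have : A.filter (G.Adj a) ⊆ (A.erase a).erase b := by
      intro w hw
      simp only [Finset.mem_filter, Finset.mem_erase] at hw ⊢
      exact ⟨fun h => hn (h ▸ hw.2), hw.2.ne', hw.1⟩
    have h := Finset.card_le_card this
    rw [Finset.card_erase_of_mem (by simp [hb, hab.symm]), Finset.card_erase_of_mem ha] at h
    have := h3 a ha
    unfold dg at this
    omega
  have Q5 : A.card = 5 → ∀ a ∈ A, ∀ b ∈ A, ∀ c ∈ A, a ≠ b → a ≠ c → b ≠ c →
      ¬ G.Adj a b → G.Adj a c := by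
    intro hA5 a ha b hb c hc hab hac hbc hn
    by_contra hn'
    have : A.filter (G.Adj a) ⊆ ((A.erase a).erase b).erase c := by
      intro w hw
      simp only [Finset.mem_filter, Finset.mem_erase] at hw ⊢
      exact ⟨fun h => hn' (h ▸ hw.2), fun h => hn (h ▸ hw.2), hw.2.ne', hw.1⟩
    have h := Finset.card_le_card this
    rw [Finset.card_erase_of_mem (by simp [hc, hac.symm, hbc.symm]),
      Finset.card_erase_of_mem (by simp [hb, hab.symm]), Finset.card_erase_of_mem ha] at h
    have := h3 a ha
    unfold dg at this
    omega
  have clique : ∀ A' ⊆ A, A'.card = 4 → (∀ a ∈ A', ∀ b ∈ A', a ≠ b → G.Adj a b) → False := by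
    intro A' hA' h4 hcl
    obtain ⟨a, ha⟩ : A'.Nonempty := Finset.card_pos.1 (by omega)
    have : (A'.erase a).card = 3 := by rw [Finset.card_erase_of_mem ha]; omega
    obtain ⟨b, c, d, hbc, hbd, hcd, he⟩ := Finset.card_eq_three.1 this
    have hb : b ∈ A'.erase a := by simp [he]
    have hc : c ∈ A'.erase a := by simp [he]
    have hd : d ∈ A'.erase a := by simp [he]
    rw [Finset.mem_erase] at hb hc hd
    exact hG.false_of_clique v a b c d (hA _ (hA' ha)) (hA _ (hA' hb.2)) (hA _ (hA' hc.2))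
      (hA _ (hA' hd.2)) (hcl _ ha _ hb.2 hb.1.symm) (hcl _ ha _ hc.2 hc.1.symm)
      (hcl _ ha _ hd.2 hd.1.symm) (hcl _ hb.2 _ hc.2 hbc) (hcl _ hb.2 _ hd.2 hbd)
      (hcl _ hc.2 _ hd.2 hcd)
  rcases hc with hc | hc
  · exact clique A subset_rfl hc (Q4 hc)
  by_cases hall : ∀ a ∈ A, ∀ b ∈ A, a ≠ b → G.Adj a b
  · obtain ⟨A', hA', h4⟩ := Finset.exists_subset_card_eq (show 4 ≤ A.card by omega)
    exact clique A' hA' h4 fun a ha b hb => hall a (hA' ha) b (hA' hb)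
  push Not at hall
  obtain ⟨a, ha, b, hb, hab, hn⟩ := hall
  have Q := Q5 hc
  have hn' : ¬ G.Adj b a := fun h => hn h.symm
  -- finish given a suitable labelling
  have fin : ∀ c d e, c ∈ A → d ∈ A → e ∈ A → c ≠ a → c ≠ b → d ≠ a → d ≠ b → e ≠ a → e ≠ b →
      c ≠ d → c ≠ e → d ≠ e → G.Adj c e → False := by
    intro c d e hc hd he hca hcb hda hdb hea heb hcd hce hde hadj
    have bd : G.Adj b d := Q b hb a ha d hd hab.symm hdb.symm hda.symm hn'
    have ad : G.Adj a d := Q a ha b hb d hd hab hda.symm hdb.symm hn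
    have ac : G.Adj a c := Q a ha b hb c hc hab hca.symm hcb.symm hn
    have ae : G.Adj a e := Q a ha b hb e he hab hea.symm heb.symm hn
    have bc : G.Adj b c := Q b hb a ha c hc hab.symm hcb.symm hca.symm hn'
    have be : G.Adj b e := Q b hb a ha e he hab.symm heb.symm hea.symm hn'
    have vd := (hA d hd).ne
    have lift : ∀ p q, p ≠ d → q ≠ d → G.Adj p q → (contr G b d).Adj p q :=
      fun p q h1 h2 h => ⟨h.ne, h1, h2, Or.inl h⟩
    refine (hG.contr bd).false_of_clique v a b c e (lift _ _ vd hda.symm (hA a ha))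
      (lift _ _ vd hdb.symm (hA b hb)) (lift _ _ vd hcd (hA c hc)) (lift _ _ vd hde.symm (hA e he))
      ⟨hab, hda.symm, hdb.symm, Or.inr (Or.inr ⟨rfl, ad.symm⟩)⟩
      (lift _ _ hda.symm hcd ac) (lift _ _ hda.symm hde.symm ae) (lift _ _ hdb.symm hcd bc)
      (lift _ _ hdb.symm hde.symm be) (lift _ _ hcd hde.symm hadj)
  have : ((A.erase a).erase b).card = 3 := by
    rw [Finset.card_erase_of_mem (by simp [hb, hab.symm]), Finset.card_erase_of_mem ha]; omega
  obtain ⟨c, d, e, hcd, hce, hde, hE⟩ := Finset.card_eq_three.1 this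
  have hc' : c ∈ (A.erase a).erase b := by simp [hE]
  have hd' : d ∈ (A.erase a).erase b := by simp [hE]
  have he' : e ∈ (A.erase a).erase b := by simp [hE]
  simp only [Finset.mem_erase] at hc' hd' he'
  by_cases h : G.Adj c e
  · exact fin c d e hc'.2.2 hd'.2.2 he'.2.2 hc'.2.1 hc'.1 hd'.2.1 hd'.1 he'.2.1 he'.1 hcd hce hde h
  · have h' := Q c hc'.2.2 e he'.2.2 d hd'.2.2 hce hcd hde.symm h
    exact fin c e d hc'.2.2 he'.2.2 hd'.2.2 hc'.2.1 hc'.1 he'.2.1 he'.1 hd'.2.1 hd'.1 hce hcd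
      hde.symm h'

lemma mader_aux (c : ℕ) : ∀ (N : ℕ) (G : SimpleGraph V) (S : Finset V), Good G → 3 ≤ S.card →
    S.card = c → E2 G S = N → E2 G S + 10 < 6 * S.card := by
  induction c using Nat.strong_induction_on with
  | _ c ih =>
  intro N
  induction N using Nat.strong_induction_on with
  | _ N ih2 =>
  intro G S hG hS hc hN
  by_contra hcon
  push Not at hcon
  have hsmall : E2 G S ≤ S.card * (S.card - 1) := by
    unfold E2
    rw [← smul_eq_mul]
    exact Finset.sum_le_card_nsmul _ _ _ fun v hv => by have := dg_le G S hv; omega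
  have h5 : 5 ≤ S.card := by
    by_contra h
    have : S.card = 3 ∨ S.card = 4 := by omega
    rcases this with h | h <;> rw [h] at hsmall hcon <;> omega
  have hdeg : ∀ v ∈ S, 4 ≤ dg G S v := by
    intro v hv
    by_contra h
    have e1 := E2_erase G S hv
    have e2 := Finset.card_erase_of_mem hv
    have := ih _ (by omega) _ G (S.erase v) hG (by omega) rfl rfl
    omega
  have hcd : ∀ x ∈ S, ∀ y ∈ S, G.Adj x y → 3 ≤ cd G S x y := by
    intro x hx y hy hxy
    by_contra h
    have e1 := E2_contr G S hx hy hxy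
    have e2 := Finset.card_erase_of_mem hy
    have := ih _ (by omega) _ (contr G x y) (S.erase y) (hG.contr hxy) (by omega) rfl rfl
    omega
  by_cases hbig : 6 * S.card ≤ E2 G S + 8
  · obtain ⟨G', h1, h2, h3⟩ := exists_delete G S (by omega)
    have := ih2 _ (by omega) G' S (hG.mono h1) hS hc rfl
    omega
  · obtain ⟨v, hv, hv'⟩ : ∃ v ∈ S, dg G S v < 6 := by
      by_contra h
      push Not at h
      have : S.card * 6 ≤ E2 G S := by
        unfold E2
        rw [← smul_eq_mul]
        exact Finset.card_nsmul_le_sum _ _ _ h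
      omega
    have h4 := hdeg v hv
    refine mader_local hG v (S.filter (G.Adj v)) (fun a ha => (Finset.mem_filter.1 ha).2) ?_ ?_
    · unfold dg at h4 hv'; omega
    · intro a ha
      rw [Finset.mem_filter] at ha
      refine (hcd v hv a ha.1 ha.2).trans (le_of_eq ?_)
      unfold cd dg
      rw [Finset.filter_filter]

lemma mader {G : SimpleGraph V} (hG : Good G) (S : Finset V) (hS : 3 ≤ S.card) :
    E2 G S + 10 < 6 * S.card :=
  mader_aux _ _ G S hG hS rfl rfl

lemma mader_weak {G : SimpleGraph V} (hG : Good G) (S : Finset V) (hS : 1 ≤ S.card) :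
    E2 G S ≤ 6 * (S.card - 1) := by
  by_cases h : 3 ≤ S.card
  · have := mader hG S h; omega
  · have hsmall : E2 G S ≤ S.card * (S.card - 1) := by
      unfold E2
      rw [← smul_eq_mul]
      exact Finset.sum_le_card_nsmul _ _ _ fun v hv => by have := dg_le G S hv; omega
    have : S.card = 1 ∨ S.card = 2 := by omega
    rcases this with h | h <;> rw [h] at hsmall ⊢ <;> omega

end mader
end PlanarMatch

namespace PlanarMatch
section link
open scoped Classical
set_option linter.unusedSectionVars false
variable {V : Type*} [DecidableEq V]

/-- Bound in the link of a vertex `x`. -/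
lemma link_bound (x : V) (c : ℕ) : ∀ (G : SimpleGraph V) (N W : Finset V), Good G → N.card = c + 1 →
    Disjoint N W → x ∉ N → x ∉ W → (∀ y ∈ N, G.Adj x y) → (∀ w ∈ W, G.Adj x w) →
    ∑ w ∈ W, (dg G N w - 1) ≤ 3 * c := by
  induction c with
  | zero =>
    intro G N W hG hN hd hxN hxW h1 h2
    refine le_of_eq (Finset.sum_eq_zero fun w hw => ?_)
    have : dg G N w ≤ N.card := Finset.card_filter_le _ _
    omega
  | succ c ih =>
    intro G N W hG hN hd hxN hxW h1 h2
    by_cases hw : ∃ w ∈ W, 2 ≤ dg G N w ∧ dg G N w ≤ 3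
    · obtain ⟨w, hw, hw2, hw3⟩ := hw
      obtain ⟨y, hy, z, hz, hyz⟩ := Finset.one_lt_card.1 (show 1 < (N.filter (G.Adj w)).card from hw2)
      rw [Finset.mem_filter] at hy hz
      have hnw : ∀ a ∈ N, a ≠ w := fun a ha h => Finset.disjoint_left.1 hd ha (h ▸ hw)
      have adj1 : (contr G y w).Adj y z :=
        ⟨hyz, hnw y hy.1, hnw z hz.1, Or.inr (Or.inl ⟨rfl, hz.2⟩)⟩
      have hG1 := hG.contr hy.2.symm
      have hG2 := hG1.contr adj1
      set G2 := contr (contr G y w) y z with hG2d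
      have lift : ∀ a b, a ≠ w → b ≠ w → a ≠ z → b ≠ z → G.Adj a b → G2.Adj a b :=
        fun a b e1 e2 e3 e4 h => ⟨h.ne, e3, e4, Or.inl ⟨h.ne, e1, e2, Or.inl h⟩⟩
      have lift2 : ∀ b, b ≠ y → b ≠ w → b ≠ z → G.Adj z b → G2.Adj y b :=
        fun b e1 e2 e3 h => ⟨e1.symm, hyz, e3, Or.inr (Or.inl ⟨rfl, h.ne, hnw z hz.1, e2, Or.inl h⟩)⟩
      have hxw : x ≠ w := (h2 w hw).ne
      have hxz : x ≠ z := (h1 z hz.1).ne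
      have hNz : (N.erase z).card = c + 1 := by rw [Finset.card_erase_of_mem hz.1]; omega
      have main := ih G2 (N.erase z) (W.erase w) hG2 hNz
        (hd.mono (Finset.erase_subset _ _) (Finset.erase_subset _ _))
        (fun h => hxN (Finset.mem_of_mem_erase h)) (fun h => hxW (Finset.mem_of_mem_erase h))
        (fun a ha => by
          rw [Finset.mem_erase] at ha
          exact lift _ _ hxw (hnw a ha.2) hxz ha.1 (h1 a ha.2))
        (fun a ha => by
          rw [Finset.mem_erase] at ha
          exact lift _ _ hxw ha.1 hxz (fun h => Finset.disjoint_left.1 hd hz.1 (h ▸ ha.2))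
            (h2 a ha.2))
      set C := (W.erase w).filter (fun a => G.Adj y a ∧ G.Adj z a) with hC
      have hCc : C.card ≤ 1 := by
        by_contra h
        obtain ⟨a, ha, b, hb, hab⟩ := Finset.one_lt_card.1 (not_le.1 h)
        simp only [hC, Finset.mem_filter, Finset.mem_erase] at ha hb
        exact hG.false_of_K33 x y z w a b (h1 y hy.1).ne hxz hyz ha.1.1.symm hb.1.1.symm hab
          (h2 w hw) (h2 a ha.1.2) (h2 b hb.1.2) hy.2.symm ha.2.1 hb.2.1 hz.2.symm ha.2.2 hb.2.2
      have step : ∀ a ∈ W.erase w, dg G N a - 1 ≤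
          (dg G2 (N.erase z) a - 1) + (if G.Adj y a ∧ G.Adj z a then 1 else 0) := by
        intro a ha
        rw [Finset.mem_erase] at ha
        have haz : a ≠ z := fun h => Finset.disjoint_left.1 hd hz.1 (h ▸ ha.2)
        have hay : a ≠ y := fun h => Finset.disjoint_left.1 hd hy.1 (h ▸ ha.2)
        have sub1 : (N.erase z).filter (G.Adj a) ⊆ (N.erase z).filter (G2.Adj a) := by
          intro b hb
          simp only [Finset.mem_filter, Finset.mem_erase] at hb ⊢
          exact ⟨hb.1, lift _ _ ha.1 (hnw b hb.1.2) haz hb.1.1 hb.2⟩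
        have k1 := Finset.card_le_card sub1
        have k2 : dg G N a ≤ ((N.erase z).filter (G.Adj a)).card + (if G.Adj z a then 1 else 0) := by
          unfold dg
          by_cases hza : G.Adj z a
          · rw [if_pos hza]
            have : N.filter (G.Adj a) ⊆ insert z ((N.erase z).filter (G.Adj a)) := by
              intro b hb
              simp only [Finset.mem_filter, Finset.mem_erase, Finset.mem_insert] at hb ⊢
              tauto
            exact (Finset.card_le_card this).trans (Finset.card_insert_le _ _)
          · rw [if_neg hza]
            refine Finset.card_le_card fun b hb => ?_
            simp only [Finset.mem_filter, Finset.mem_erase] at hb ⊢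
            exact ⟨⟨fun h => hza (h ▸ hb.2.symm), hb.1⟩, hb.2⟩
        by_cases hza : G.Adj z a
        · by_cases hya : G.Adj y a
          · simp only [hza, hya, and_self, if_true] at k2 ⊢
            unfold dg at k2 ⊢
            omega
          · have sub2 : insert y ((N.erase z).filter (G.Adj a)) ⊆ (N.erase z).filter (G2.Adj a) := by
              intro b hb
              rw [Finset.mem_insert] at hb
              rcases hb with rfl | hb
              · rw [Finset.mem_filter, Finset.mem_erase]
                exact ⟨⟨hyz, hy.1⟩, (lift2 a hay ha.1 haz hza).symm⟩
              · exact sub1 hb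
            have k3 := Finset.card_le_card sub2
            rw [Finset.card_insert_of_notMem (by simp [G.adj_comm a y, hya])] at k3
            simp only [hza, hya, if_true] at k2 ⊢
            unfold dg at k2 ⊢
            omega
        · simp only [hza, if_false, and_false] at k2 ⊢
          unfold dg at k2 ⊢
          omega
      have hsum := Finset.sum_le_sum step
      rw [Finset.sum_add_distrib, ← Finset.card_filter, ← hC] at hsum
      rw [← Finset.add_sum_erase _ _ hw]
      omega
    · push Not at hw
      set W4 := W.filter (fun w => 4 ≤ dg G N w) with hW4
      have hW : ∑ w ∈ W, (dg G N w - 1) = ∑ w ∈ W4, (dg G N w - 1) := by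
        rw [hW4, Finset.sum_filter]
        refine Finset.sum_congr rfl fun w hw' => ?_
        have := hw w hw'
        split_ifs <;> omega
      have hdeg : ∀ w ∈ W4, 4 ≤ dg G N w := fun w hw => (Finset.mem_filter.1 hw).2
      have hsub : W4 ⊆ W := Finset.filter_subset _ _
      have hd4 : Disjoint N W4 := hd.mono_right hsub
      by_cases hy : ∃ y ∈ N, dg G W4 y ≤ 3
      · obtain ⟨y, hy, hy3⟩ := hy
        have hNy : (N.erase y).card = c + 1 := by rw [Finset.card_erase_of_mem hy]; omega
        have main := ih G (N.erase y) W4 hG hNy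
          (hd4.mono_left (Finset.erase_subset _ _))
          (fun h => hxN (Finset.mem_of_mem_erase h)) (fun h => hxW (hsub h))
          (fun a ha => h1 a (Finset.mem_of_mem_erase ha)) (fun a ha => h2 a (hsub ha))
        have step : ∀ a ∈ W4, dg G N a - 1 ≤
            (dg G (N.erase y) a - 1) + (if G.Adj y a then 1 else 0) := by
          intro a ha
          have h4 := hdeg a ha
          have : dg G N a ≤ dg G (N.erase y) a + (if G.Adj y a then 1 else 0) := by
            unfold dg
            by_cases hya : G.Adj y a
            · rw [if_pos hya]
              have : N.filter (G.Adj a) ⊆ insert y ((N.erase y).filter (G.Adj a)) := by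
                intro b hb
                simp only [Finset.mem_filter, Finset.mem_erase, Finset.mem_insert] at hb ⊢
                tauto
              exact (Finset.card_le_card this).trans (Finset.card_insert_le _ _)
            · rw [if_neg hya]
              refine Finset.card_le_card fun b hb => ?_
              simp only [Finset.mem_filter, Finset.mem_erase] at hb ⊢
              exact ⟨⟨fun h => hya (h ▸ hb.2.symm), hb.1⟩, hb.2⟩
          split_ifs at this ⊢ <;> omega
        have hsum := Finset.sum_le_sum step
        rw [Finset.sum_add_distrib, ← Finset.card_filter] at hsum
        have hy3' : (W4.filter (fun i => G.Adj y i)).card ≤ 3 := hy3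
        rw [hW]
        omega
      · push Not at hy
        exfalso
        have e1 : N.card * 4 ≤ ∑ y ∈ N, dg G W4 y := by
          rw [← smul_eq_mul]; exact Finset.card_nsmul_le_sum _ _ _ hy
        have e2 : W4.card * 4 ≤ ∑ w ∈ W4, dg G N w := by
          rw [← smul_eq_mul]; exact Finset.card_nsmul_le_sum _ _ _ hdeg
        rw [sum_dg_comm G W4 N] at e2
        have e3 := E2_union G N W4 hd4
        have hxNW : x ∉ N ∪ W4 := by
          rw [Finset.mem_union]; rintro (h | h)
          · exact hxN h
          · exact hxW (hsub h)
        have e4 := E2_erase G (insert x (N ∪ W4)) (Finset.mem_insert_self x _)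
        rw [Finset.erase_insert hxNW] at e4
        have e5 : dg G (insert x (N ∪ W4)) x = N.card + W4.card := by
          rw [← Finset.card_union_of_disjoint hd4, ← dg_erase_self, Finset.erase_insert hxNW]
          unfold dg
          rw [Finset.filter_true_of_mem]
          intro a ha
          rcases Finset.mem_union.1 ha with h | h
          · exact h1 a h
          · exact h2 a (hsub h)
        have e6 : (insert x (N ∪ W4)).card = N.card + W4.card + 1 := by
          rw [Finset.card_insert_of_notMem hxNW, Finset.card_union_of_disjoint hd4]
        have e7 := mader hG (insert x (N ∪ W4)) (by omega)
        omega

end link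
end PlanarMatch

namespace PlanarMatch
section tlemma
open scoped Classical
set_option linter.unusedSectionVars false
variable {V : Type*} [DecidableEq V]

lemma T_aux (c : ℕ) : ∀ (G : SimpleGraph V) (B U : Finset V), Good G → Disjoint B U →
    (∀ a ∈ U, ∀ b ∈ U, ¬ G.Adj a b) → 2 ≤ B.card → B.card + U.card = c →
    E2 G (B ∪ U) + 18 < 4 * U.card + 16 * B.card := by
  induction c using Nat.strong_induction_on with
  | _ c ih =>
  intro G B U hG hd hU hB hc
  have hdU : ∀ u ∈ U, dg G U u = 0 := fun u hu => by
    unfold dg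
    rw [Finset.card_eq_zero, Finset.filter_eq_empty_iff]
    exact fun b hb => hU u hu b hb
  have hEU : E2 G U = 0 := Finset.sum_eq_zero hdU
  by_cases hB3 : B.card = 2
  · have e1 := E2_union G B U hd
    have e2 := mader_weak hG B (by omega)
    have e3 : ∑ v ∈ B, dg G U v ≤ B.card * U.card := by
      rw [← smul_eq_mul]
      exact Finset.sum_le_card_nsmul _ _ _ fun v _ => Finset.card_filter_le _ _
    rw [hB3] at e2 e3 ⊢
    omega
  by_contra hcon
  push Not at hcon
  have hU3 : ∀ u ∈ U, u ∉ B := fun u hu hb => Finset.disjoint_left.1 hd hb hu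
  have hB3' : ∀ u ∈ B, u ∉ U := fun u hu hb => Finset.disjoint_left.1 hd hu hb
  have hx9 : ∀ x ∈ B, 9 ≤ dg G (B ∪ U) x := by
    intro x hx
    by_contra h
    have e1 := E2_erase G (B ∪ U) (Finset.mem_union_left _ hx)
    have e2 := Finset.card_erase_of_mem hx
    have e3 : (B ∪ U).erase x = B.erase x ∪ U := by
      rw [Finset.erase_union_distrib, Finset.erase_eq_of_notMem (hB3' x hx)]
    rw [e3] at e1
    have := ih _ (by omega) G (B.erase x) U hG (hd.mono_left (Finset.erase_subset _ _)) hU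
      (by omega) rfl
    omega
  have hcB : ∀ x ∈ B, ∀ y ∈ B, G.Adj x y → 8 ≤ cd G (B ∪ U) x y := by
    intro x hx y hy hxy
    by_contra h
    have e1 := E2_contr G (B ∪ U) (Finset.mem_union_left _ hx) (Finset.mem_union_left _ hy) hxy
    have e2 := Finset.card_erase_of_mem hy
    have e3 : (B ∪ U).erase y = B.erase y ∪ U := by
      rw [Finset.erase_union_distrib, Finset.erase_eq_of_notMem (hB3' y hy)]
    rw [e3] at e1
    have := ih _ (by omega) (contr G x y) (B.erase y) U (hG.contr hxy)
      (hd.mono_left (Finset.erase_subset _ _)) (by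
        rintro a ha b hb ⟨-, -, -, h | h | h⟩
        · exact hU a ha b hb h
        · exact hB3' x hx (h.1 ▸ ha)
        · exact hB3' x hx (h.1 ▸ hb))
      (by omega) rfl
    omega
  have hcU : ∀ x ∈ B, ∀ u ∈ U, G.Adj x u → 2 ≤ cd G (B ∪ U) x u := by
    intro x hx y hy hxy
    by_contra h
    have e1 := E2_contr G (B ∪ U) (Finset.mem_union_left _ hx) (Finset.mem_union_right _ hy) hxy
    have e2 := Finset.card_erase_add_one hy
    have e3 : (B ∪ U).erase y = B ∪ U.erase y := by
      rw [Finset.erase_union_distrib, Finset.erase_eq_of_notMem (hU3 y hy)]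
    rw [e3] at e1
    have := ih _ (by omega) (contr G x y) B (U.erase y) (hG.contr hxy)
      (hd.mono_right (Finset.erase_subset _ _)) (by
        rintro a ha b hb ⟨-, -, -, h | h | h⟩
        · exact hU a (Finset.mem_of_mem_erase ha) b (Finset.mem_of_mem_erase hb) h
        · exact hB3' x hx (h.1 ▸ Finset.mem_of_mem_erase ha)
        · exact hB3' x hx (h.1 ▸ Finset.mem_of_mem_erase hb))
      (by omega) rfl
    omega
  obtain ⟨x, hx, hx5⟩ : ∃ x ∈ B, dg G B x < 6 := by
    by_contra h
    push Not at h
    have h1 : B.card * 6 ≤ E2 G B := by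
      unfold E2
      rw [← smul_eq_mul]
      exact Finset.card_nsmul_le_sum _ _ _ h
    have := mader hG B (by omega)
    omega
  set N := B.filter (G.Adj x) with hN
  set W := U.filter (G.Adj x) with hW
  have hNx : ∀ y ∈ N, G.Adj x y := fun y hy => (Finset.mem_filter.1 hy).2
  have hWx : ∀ y ∈ W, G.Adj x y := fun y hy => (Finset.mem_filter.1 hy).2
  have hNB : N ⊆ B := Finset.filter_subset _ _
  have hWU : W ⊆ U := Finset.filter_subset _ _
  have hxN : x ∉ N := fun h => (hNx x h).ne rfl
  have hxW : x ∉ W := fun h => (hWx x h).ne rfl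
  have hNc : N.card < 6 := hx5
  have hW2 : ∀ w ∈ W, 2 ≤ dg G N w := by
    intro w hw
    refine (hcU x hx w (hWU hw) (hWx w hw)).trans (Finset.card_le_card ?_)
    intro b hb
    simp only [Finset.mem_filter, Finset.mem_union, hN] at hb ⊢
    refine ⟨⟨hb.1.resolve_right fun h => hU w (hWU hw) b h hb.2.2, hb.2.1⟩, hb.2.2⟩
  have hdx : dg G (B ∪ U) x = N.card + W.card := dg_split G B U hd x
  have hN1 : 1 ≤ N.card := by
    have h9 := hx9 x hx
    rcases Finset.eq_empty_or_nonempty W with h | ⟨w, hw⟩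
    · rw [h, Finset.card_empty] at hdx; omega
    · have h1 := hW2 w hw
      have h2 : dg G N w ≤ N.card := Finset.card_filter_le _ _
      omega
  have hdNW : Disjoint N W := hd.mono hNB hWU
  have hL := link_bound x (N.card - 1) G N W hG (by omega) hdNW hxN hxW hNx hWx
  have hL2 : ∑ w ∈ W, dg G N w ≤ 2 * ∑ w ∈ W, (dg G N w - 1) := by
    rw [Finset.mul_sum]
    exact Finset.sum_le_sum fun w hw => by have := hW2 w hw; omega
  have hcd : ∀ y ∈ N, 8 ≤ dg G N y + dg G W y := by
    intro y hy
    refine (hcB x hx y (hNB hy) (hNx y hy)).trans (le_of_eq ?_)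
    rw [← dg_split G N W hdNW]
    unfold dg cd
    congr 1
    ext b
    simp only [Finset.mem_filter, Finset.mem_union, hN, hW]
    tauto
  have hS : N.card * 8 ≤ E2 G N + ∑ y ∈ N, dg G W y := by
    unfold E2
    rw [← Finset.sum_add_distrib, ← smul_eq_mul]
    exact Finset.card_nsmul_le_sum _ _ _ hcd
  rw [sum_dg_comm G N W] at hS
  by_cases h1 : N.card = 1
  · have := mader_weak hG N (by omega)
    rw [h1] at *
    omega
  · have e4 := E2_erase G (insert x N) (Finset.mem_insert_self x _)
    rw [Finset.erase_insert hxN] at e4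
    have e5 : dg G (insert x N) x = N.card := by
      rw [← dg_erase_self, Finset.erase_insert hxN]
      unfold dg
      rw [Finset.filter_true_of_mem hNx]
    have e6 : (insert x N).card = N.card + 1 := Finset.card_insert_of_notMem hxN
    have e7 := mader hG (insert x N) (by omega)
    omega

lemma T_bound {G : SimpleGraph V} (hG : Good G) (B U : Finset V) (hd : Disjoint B U)
    (hU : ∀ a ∈ U, ∀ b ∈ U, ¬ G.Adj a b) (hB : 2 ≤ B.card) :
    E2 G (B ∪ U) + 18 < 4 * U.card + 16 * B.card :=
  T_aux _ G B U hG hd hU hB rfl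

end tlemma
end PlanarMatch

namespace PlanarMatch
section planar
open scoped Classical

lemma good_of_planar {V : Type*} {G : SimpleGraph V} (h : G.IsPlanar) : Good G := by
  obtain ⟨f, γ, hf, hc, hi, he, hv, hd⟩ := h
  set L := Complex.equivRealProdCLM.symm with hL
  refine ⟨fun v => L (f v), fun a b => if h : s(a, b) ∈ G.edgeSet then
    (fun t => L (γ ⟨s(a, b), h⟩ t)) '' Set.Icc 0 1 else ∅, ?_, ?_⟩
  · intro a b hab
    replace hab : s(a, b) ∈ G.edgeSet := hab
    dsimp only
    rw [dif_pos hab]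
    have hcont : ContinuousOn (fun t => L (γ ⟨s(a, b), hab⟩ t)) (Set.Icc 0 1) :=
      L.continuous.comp_continuousOn (hc _)
    obtain ⟨u, v, huv, h0, h1⟩ := he ⟨s(a, b), hab⟩
    rcases Sym2.eq_iff.1 huv with ⟨rfl, rfl⟩ | ⟨rfl, rfl⟩
    · exact JoinedIn.ofLine hcont (by simp only [h0]) (by simp only [h1]) subset_rfl
    · exact (JoinedIn.ofLine hcont (by simp only [h0]) (by simp only [h1]) subset_rfl).symm
  · intro a b c d hab hcd hac had hbc hbd
    replace hab : s(a, b) ∈ G.edgeSet := hab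
    replace hcd : s(c, d) ∈ G.edgeSet := hcd
    dsimp only
    rw [dif_pos hab, dif_pos hcd, Set.disjoint_left]
    rintro _ ⟨t, ht, rfl⟩ ⟨t', ht', heq⟩
    have heq : γ ⟨s(c, d), hcd⟩ t' = γ ⟨s(a, b), hab⟩ t := L.injective heq
    have key : ∀ (e : G.edgeSet) (t : ℝ), t ∈ Set.Icc (0 : ℝ) 1 → t ∈ Set.Ioo (0 : ℝ) 1 ∨
        ∃ v, v ∈ (e : Sym2 V) ∧ γ e t = f v := by
      intro e t ht
      obtain ⟨u, v, huv, h0, h1⟩ := he e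
      rcases eq_or_lt_of_le ht.1 with rfl | h2
      · exact Or.inr ⟨u, by rw [huv]; simp, h0⟩
      · rcases eq_or_lt_of_le ht.2 with rfl | h3
        · exact Or.inr ⟨v, by rw [huv]; simp, h1⟩
        · exact Or.inl ⟨h2, h3⟩
    rcases key _ _ ht with h1 | ⟨v, hv1, hv2⟩ <;> rcases key _ _ ht' with h2 | ⟨w, hw1, hw2⟩
    · refine hd ⟨s(c, d), hcd⟩ ⟨s(a, b), hab⟩ (fun h => ?_) t' h2 t h1 heq
      have := Sym2.eq_iff.1 (congrArg Subtype.val h)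
      tauto
    · exact hv _ t h1 w (heq ▸ hw2)
    · exact hv _ t' h2 v (heq.trans hv2)
    · have : v = w := hf (by rw [← hv2, ← hw2, heq])
      subst this
      simp only [Sym2.mem_iff] at hv1 hw1
      rcases hv1 with rfl | rfl <;> rcases hw1 with rfl | rfl <;> tauto

end planar
end PlanarMatch

namespace PlanarMatch
section berge
open scoped Classical

lemma E2_components {X : Type*} [Fintype X] {F : SimpleGraph X} (hF : Good F) :
    E2 F Finset.univ + 6 * Nat.card F.ConnectedComponent ≤ 6 * Fintype.card X := by
  rw [Nat.card_eq_fintype_card]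
  have h1 : E2 F Finset.univ = ∑ c : F.ConnectedComponent,
      E2 F (Finset.univ.filter fun v => F.connectedComponentMk v = c) := by
    unfold E2
    rw [← Finset.sum_fiberwise Finset.univ (fun v => F.connectedComponentMk v)]
    refine Finset.sum_congr rfl fun c _ => Finset.sum_congr rfl fun v hv => ?_
    unfold dg
    congr 1
    ext w
    simp only [Finset.mem_filter, Finset.mem_univ, true_and] at hv ⊢
    refine ⟨fun h => ⟨?_, h⟩, fun h => h.2⟩
    rw [← hv]
    exact (SimpleGraph.ConnectedComponent.connectedComponentMk_eq_of_adj h).symm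
  have h2 : Fintype.card X = ∑ c : F.ConnectedComponent,
      (Finset.univ.filter fun v => F.connectedComponentMk v = c).card := by
    rw [← Finset.card_univ]
    exact Finset.card_eq_sum_card_fiberwise (fun _ _ => Finset.mem_univ _)
  have h3 : 6 * Fintype.card F.ConnectedComponent = ∑ c : F.ConnectedComponent, 6 := by
    simp [mul_comm]
  rw [h1, h2, h3, ← Finset.sum_add_distrib, Finset.mul_sum]
  refine Finset.sum_le_sum fun c _ => ?_
  have hpos : 1 ≤ (Finset.univ.filter fun v => F.connectedComponentMk v = c).card := by
    obtain ⟨v, rfl⟩ := c.exists_rep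
    exact Finset.card_pos.2 ⟨v, by simp; rfl⟩
  have := mader_weak hF _ hpos
  omega

lemma E2_image {X V : Type*} [Fintype X] [DecidableEq V] {F : SimpleGraph X} {G : SimpleGraph V}
    (φ : X → V) (hφ : Function.Injective φ) (h : ∀ a b, G.Adj (φ a) (φ b) ↔ F.Adj a b) :
    E2 G (Finset.univ.image φ) = E2 F Finset.univ := by
  unfold E2
  rw [Finset.sum_image fun _ _ _ _ h => hφ h]
  refine Finset.sum_congr rfl fun v _ => ?_
  unfold dg
  rw [Finset.filter_image, Finset.card_image_of_injective _ hφ]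
  simp [h]

/-- Join of `G` with a complete graph on `m` new vertices. -/
def jn {V : Type*} (G : SimpleGraph V) (m : ℕ) : SimpleGraph (V ⊕ Fin m) where
  Adj x y := x ≠ y ∧ ∀ a b, x = Sum.inl a → y = Sum.inl b → G.Adj a b
  symm := ⟨fun _ _ h => ⟨h.1.symm, fun a b ha hb => (h.2 b a hb ha).symm⟩⟩
  loopless := ⟨fun _ h => h.1 rfl⟩

lemma matching_of_perfect {n k : ℕ} (hn : 2 * k ≤ n) (G : SimpleGraph (Fin n))
    (M : (jn G (n - 2 * k)).Subgraph) (hM : M.IsPerfectMatching) :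
    ∃ M : Finset (Sym2 (Fin n)), IsMatchingOfSize G M k := by
  rw [SimpleGraph.Subgraph.isPerfectMatching_iff] at hM
  let H : SimpleGraph (Fin n) := 
    { Adj := fun a b => M.Adj (Sum.inl a) (Sum.inl b)
      symm := ⟨fun _ _ h => h.symm⟩
      loopless := ⟨fun _ h => h.ne rfl⟩ }
  have hHG : H ≤ G := fun a b h => (M.adj_sub h).2 a b rfl rfl
  have huniq : ∀ a b c, H.Adj a b → H.Adj a c → b = c := fun a b c h1 h2 =>
    Sum.inl_injective ((hM (Sum.inl a)).unique h1 h2)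
  set A := Finset.univ.filter (fun a => ∃ b, H.Adj a b) with hA
  have hAc : Aᶜ.card ≤ n - 2 * k := by
    choose g hg _ using hM
    have : ∀ a ∈ Aᶜ, ∃ j, g (Sum.inl a) = Sum.inr j := by
      intro a ha
      rcases h : g (Sum.inl a) with b | j
      · exfalso
        simp only [hA, Finset.mem_compl, Finset.mem_filter, Finset.mem_univ, true_and] at ha
        refine ha ⟨b, ?_⟩
        have := hg (Sum.inl a)
        dsimp only at this
        rw [h] at this
        exact this
      · exact ⟨j, rfl⟩
    have h2 : Aᶜ.card ≤ (Finset.univ.image (Sum.inr : Fin (n - 2 * k) → Fin n ⊕ Fin (n - 2 * k))).card := by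
      refine Finset.card_le_card_of_injOn (fun a => g (Sum.inl a)) ?_ ?_
      · intro a ha
        obtain ⟨j, hj⟩ := this a ha
        simp [hj]
      · intro a _ b _ hab
        have h1 := (hg (Sum.inl a)).symm
        have h2 := (hg (Sum.inl b)).symm
        dsimp only at hab h1 h2
        rw [hab] at h1
        exact Sum.inl_injective ((‹∀ v, ∀ y, _› : ∀ v y, M.Adj v y → y = g v) _ _ h1 |>.trans
          ((‹∀ v, ∀ y, _› : ∀ v y, M.Adj v y → y = g v) _ _ h2).symm)
    refine h2.trans (Finset.card_image_le.trans ?_)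
    simp
  have hdeg : ∀ a ∈ A, 1 ≤ H.degree a := by
    intro a ha
    obtain ⟨b, hb⟩ := (Finset.mem_filter.1 ha).2
    exact Finset.card_pos.2 ⟨b, by simpa using hb⟩
  have h1 := H.sum_degrees_eq_twice_card_edges
  have h2 : A.card ≤ ∑ v, H.degree v := by
    calc A.card = ∑ a ∈ A, 1 := by simp
      _ ≤ ∑ a ∈ A, H.degree a := Finset.sum_le_sum hdeg
      _ ≤ _ := Finset.sum_le_sum_of_subset (Finset.subset_univ _)
  have h3 : A.card + Aᶜ.card = n := by simp [Finset.card_add_card_compl]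
  obtain ⟨T, hT, hTc⟩ := Finset.exists_subset_card_eq (show k ≤ H.edgeFinset.card by omega)
  refine ⟨T, hTc, fun e he => ?_, ?_⟩
  · have := hT he
    rw [SimpleGraph.mem_edgeFinset] at this
    exact SimpleGraph.edgeSet_mono hHG this
  · intro e he e' he' hne v hv hv'
    have h1 := hT he
    have h2 := hT he'
    rw [SimpleGraph.mem_edgeFinset] at h1 h2
    obtain ⟨a, rfl⟩ := hv
    obtain ⟨b, rfl⟩ := hv'
    exact hne (by rw [huniq v a b h1 h2])

lemma berge {n k : ℕ} (hn : 2 * k ≤ n) (G : SimpleGraph (Fin n)) (hG : Good G)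
    (hfree : ¬ ∃ M : Finset (Sym2 (Fin n)), IsMatchingOfSize G M k) :
    ∃ S : Finset (Fin n), E2 G Sᶜ + 6 * (S.card + (n - 2 * k + 2)) ≤ 6 * (n - S.card) := by
  have h1 : ¬ ∃ M : (jn G (n - 2 * k)).Subgraph, M.IsPerfectMatching :=
    fun ⟨M, hM⟩ => hfree (matching_of_perfect hn G M hM)
  rw [SimpleGraph.tutte] at h1
  push Not at h1
  obtain ⟨S', hS'⟩ := h1
  unfold SimpleGraph.IsTutteViolator at hS'
  set F := ((⊤ : (jn G (n - 2 * k)).Subgraph).deleteVerts S').coe with hF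
  have hmem : ∀ x, x ∈ ((⊤ : (jn G (n - 2 * k)).Subgraph).deleteVerts S').verts ↔ x ∉ S' := by
    intro x; simp
  have hadj : ∀ a b, F.Adj a b ↔ (jn G (n - 2 * k)).Adj a.1 b.1 := by
    intro a b
    have ha := (hmem _).1 a.2
    have hb := (hmem _).1 b.2
    simp only [hF, SimpleGraph.Subgraph.coe_adj, SimpleGraph.Subgraph.deleteVerts_adj,
      SimpleGraph.Subgraph.verts_top, Set.mem_univ, true_and, SimpleGraph.Subgraph.top_adj, ha, hb,
      not_false_eq_true]
  have hcard : Nat.card ((⊤ : (jn G (n - 2 * k)).Subgraph).deleteVerts S').verts + S'.ncard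
      = n + (n - 2 * k) := by
    have : ((⊤ : (jn G (n - 2 * k)).Subgraph).deleteVerts S').verts = S'ᶜ := by
      ext x; simp
    rw [this, Nat.card_coe_set_eq, add_comm, Set.ncard_add_ncard_compl]
    simp
  have hpar := F.odd_ncard_oddComponents
  have hodd : S'.ncard + 2 ≤ F.oddComponents.ncard := by
    by_contra hlt
    have : F.oddComponents.ncard = S'.ncard + 1 := by omega
    rw [this] at hpar
    rw [Nat.odd_iff, Nat.odd_iff] at hpar
    omega
  have hcc : F.oddComponents.ncard ≤ Nat.card F.ConnectedComponent := by
    exact Set.ncard_le_card _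
  have hinr : ∀ j, Sum.inr j ∈ S' := by
    intro j
    by_contra hj
    have hreach : ∀ a, F.connectedComponentMk a = F.connectedComponentMk ⟨Sum.inr j, (hmem _).2 hj⟩ := by
      intro a
      by_cases ha : a.1 = Sum.inr j
      · congr 1
        exact Subtype.ext ha
      · apply SimpleGraph.ConnectedComponent.connectedComponentMk_eq_of_adj
        rw [hadj]
        exact ⟨ha, fun _ _ _ h => by cases h⟩
    have : Subsingleton F.ConnectedComponent := by
      refine ⟨fun c d => ?_⟩
      obtain ⟨a, rfl⟩ := c.exists_rep
      obtain ⟨b, rfl⟩ := d.exists_rep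
      exact (hreach a).trans (hreach b).symm
    have := Finite.card_le_one_iff_subsingleton.2 this
    omega
  have hphi : ∀ x : ((⊤ : (jn G (n - 2 * k)).Subgraph).deleteVerts S').verts, ∃ a : Fin n, x.1 = Sum.inl a := by
    rintro ⟨a | j, hx⟩
    · exact ⟨a, rfl⟩
    · exact absurd (hinr j) ((hmem _).1 hx)
  choose φ hφ using hphi
  have hφi : Function.Injective φ := fun x y h => Subtype.ext (by rw [hφ, hφ, h])
  have hφa : ∀ a b, G.Adj (φ a) (φ b) ↔ F.Adj a b := by
    intro a b
    rw [hadj, hφ, hφ]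
    constructor
    · intro h
      refine ⟨fun h' => h.ne (Sum.inl_injective h'), ?_⟩
      intro c d hc hd
      rw [← Sum.inl_injective hc, ← Sum.inl_injective hd]
      exact h
    · intro h
      exact h.2 _ _ rfl rfl
  have hFG : Good F := hG.comap φ hφi fun a b h => (hφa a b).2 h
  have e1 := E2_components hFG
  rw [← E2_image φ hφi hφa] at e1
  have e2 : (Finset.univ.image φ).card = Nat.card ((⊤ : (jn G (n - 2 * k)).Subgraph).deleteVerts S').verts := by
    rw [Finset.card_image_of_injective _ hφi, Finset.card_univ, Nat.card_eq_fintype_card]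
  have e3 : (Finset.univ.image φ).card + (Finset.univ.image φ)ᶜ.card = n := by
    simp [Finset.card_add_card_compl]
  refine ⟨(Finset.univ.image φ)ᶜ, ?_⟩
  rw [compl_compl]
  rw [← Nat.card_eq_fintype_card] at e1
  omega

end berge

section final
open scoped Classical

lemma final_bound (n k : ℕ) (hk : 3 ≤ k) (hn : 2 * k ≤ n) (G : SimpleGraph (Fin n)) (hG : Good G)
    (hfree : ¬ ∃ M : Finset (Sym2 (Fin n)), IsMatchingOfSize G M k) :
    G.edgeSet.ncard ≤ 2 * n + 6 * k - 16 := by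
  obtain ⟨S, hS⟩ := berge hn G hG hfree
  have hc : S.card + Sᶜ.card = n := by simp [Finset.card_add_card_compl]
  have hE : 2 * G.edgeSet.ncard = E2 G (S ∪ Sᶜ) := by
    rw [Finset.union_compl, Set.ncard_eq_toFinset_card']
    change 2 * G.edgeFinset.card = _
    rw [← SimpleGraph.sum_degrees_eq_twice_card_edges]
    unfold E2 dg
    refine Finset.sum_congr rfl fun v _ => ?_
    rw [← SimpleGraph.card_neighborFinset_eq_degree]
    congr 1
    ext w
    simp
  have hd : Disjoint S Sᶜ := disjoint_compl_right
  have e1 := E2_union G S Sᶜ hd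
  have e0 : ∑ v ∈ S, dg G Sᶜ v ≤ S.card * Sᶜ.card := by
    rw [← smul_eq_mul]
    exact Finset.sum_le_card_nsmul _ _ _ fun v _ => Finset.card_filter_le _ _
  by_cases h2 : 2 ≤ S.card
  · let H : SimpleGraph (Fin n) :=
      { Adj := fun a b => G.Adj a b ∧ (a ∈ S ∨ b ∈ S)
        symm := ⟨fun _ _ h => ⟨h.1.symm, h.2.symm⟩⟩
        loopless := ⟨fun _ h => h.1.ne rfl⟩ }
    have hH : Good H := hG.mono fun a b h => h.1
    have hHU : ∀ a ∈ Sᶜ, ∀ b ∈ Sᶜ, ¬ H.Adj a b := by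
      rintro a ha b hb ⟨-, h | h⟩
      · exact Finset.mem_compl.1 ha h
      · exact Finset.mem_compl.1 hb h
    have hT := T_bound hH S Sᶜ hd hHU h2
    have e2 := E2_union H S Sᶜ hd
    have hdg : ∀ A : Finset (Fin n), ∀ v ∈ S, dg H A v = dg G A v := by
      intro A v hv
      unfold dg
      congr 1
      ext w
      simp only [Finset.mem_filter, H, hv, true_or, and_true]
    have e3 : E2 H S = E2 G S := Finset.sum_congr rfl fun v hv => hdg S v hv
    have e4 : ∑ v ∈ S, dg H Sᶜ v = ∑ v ∈ S, dg G Sᶜ v :=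
      Finset.sum_congr rfl fun v hv => hdg Sᶜ v hv
    omega
  · have : S.card = 0 ∨ S.card = 1 := by omega
    rcases this with h | h
    · have h0 : E2 G S = 0 := by rw [Finset.card_eq_zero.1 h]; simp [E2]
      rw [h] at e0 hS
      omega
    · have h0 := mader_weak hG S (by omega)
      rw [h] at e0 hS h0
      omega

end final
end PlanarMatch


/-- Let `k ≥ 3`, `n ≥ 2k`, and let `G` be a planar simple graph on `n` vertices that
contains a matching of size `k − 1` but no matching of size `k`. Then `G` has at most
`2n + 6k − 16` edges. -/
theorem planar_kMatchingFree_edge_bound (n k : ℕ) (hk : 3 ≤ k) (hn : 2 * k ≤ n)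
    (G : SimpleGraph (Fin n)) (hpl : G.IsPlanar)
    (hsub : ∃ M : Finset (Sym2 (Fin n)), IsMatchingOfSize G M (k - 1))
    (hfree : ¬ ∃ M : Finset (Sym2 (Fin n)), IsMatchingOfSize G M k) :
    G.edgeSet.ncard ≤ 2 * n + 6 * k - 16 := by
  exact PlanarMatch.final_bound n k hk hn G (PlanarMatch.good_of_planar hpl) hfree
end
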